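/- arXiv:2305.08331 — 2 statements merged into one kernel-verified Lean document; each statement's English description precedes it below -/
import Mathlib

section
/- For every integer n ≥ 16, the maximum number of edges of an n-vertex C4-free Halin graph equals 5(n−1)/3 if n ≡ 1 (mod 3), equals 5(n−2)/3 + 1 if n ≡ 2 (mod 3), and equals 5(n−3)/3 + 3 if n ≡ 0 (mod 3); that is, this value is attained by some n-vertex C4-free Halin graph and no n-vertex C4-free Halin graph has more edges. -/
open SimpleGraph

/-- Degree of a vertex as the `ncard` of its neighbour set. -/
noncomputable def ncDeg {V : Type*} (G : SimpleGraph V) (v : V) : ℕ :=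
  (G.neighborSet v).ncard

/-- A leaf is a vertex of degree one. -/
def IsLeaf {V : Type*} (G : SimpleGraph V) (v : V) : Prop :=
  ncDeg G v = 1

/-- A Halin graph, presented by its characteristic tree `T` and outer cycle `C`.
The underlying graph is `T ⊔ C`.  The outer cycle is a `2`-regular connected graph
whose support is exactly the set of leaves of `T`, every non-leaf of `T` has degree
at least three, and the cycle is compatible with a planar embedding: for every edge
`uv` of `T`, the leaves lying in each component of `T - uv` are consecutive on the
cycle, i.e. they induce a connected subgraph of the cycle. -/
structure HalinGraph (V : Type*) [Fintype V] : Type _ where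
  /-- the characteristic tree -/
  T : SimpleGraph V
  /-- the outer cycle -/
  C : SimpleGraph V
  tree_isTree : T.IsTree
  four_le_card : 4 ≤ Fintype.card V
  nonleaf_degree : ∀ v : V, ¬ IsLeaf T v → 3 ≤ ncDeg T v
  support_C : C.support = {v : V | IsLeaf T v}
  two_regular : ∀ v ∈ C.support, ncDeg C v = 2
  cycle_connected : (C.induce C.support).Connected
  planar : ∀ u v : V, T.Adj u v →
    (C.induce {x : V | IsLeaf T x ∧ (T.deleteEdges {s(u, v)}).Reachable u x}).Connected

/-- The Halin graph itself: the (edge-disjoint) union of the tree and the outer cycle. -/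
def HalinGraph.graph {V : Type*} [Fintype V] (H : HalinGraph V) : SimpleGraph V :=
  H.T ⊔ H.C

/-- Number of edges of a graph. -/
noncomputable def eCount {V : Type*} (G : SimpleGraph V) : ℕ :=
  G.edgeSet.ncard

/-- A graph is `C₄`-free iff it contains no cycle of length `4`. -/
def C4Free {V : Type*} (G : SimpleGraph V) : Prop :=
  ∀ (v : V) (w : G.Walk v v), w.IsCycle → w.length ≠ 4

/-- A semi-branching vertex of the characteristic tree: a non-leaf with at least one
leaf neighbour and at least two non-leaf neighbours. -/
def SemiBranching {V : Type*} (T : SimpleGraph V) (v : V) : Prop :=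
  ¬ IsLeaf T v ∧ (∃ x, T.Adj v x ∧ IsLeaf T x) ∧
    ∃ x y : V, x ≠ y ∧ T.Adj v x ∧ T.Adj v y ∧ ¬ IsLeaf T x ∧ ¬ IsLeaf T y


namespace HalinTuran

open Finset

lemma ncDeg_eq_degree {V : Type*} [Fintype V] (G : SimpleGraph V) [DecidableRel G.Adj] (v : V) :
    ncDeg G v = G.degree v := by
  rw [ncDeg, Set.ncard_eq_toFinset_card']
  rfl

lemma eCount_eq_card_edgeFinset {V : Type*} (G : SimpleGraph V) [Fintype G.edgeSet] :
    eCount G = #G.edgeFinset := by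
  rw [eCount, Set.ncard_eq_toFinset_card']
  rfl

/-- A graph is `C₄`-free iff no closed chain of four edges has distinct opposite corners. -/
lemma c4Free_iff {V : Type*} (G : SimpleGraph V) :
    C4Free G ↔ ∀ a b c d : V, G.Adj a b → G.Adj b c → G.Adj c d → G.Adj d a →
      a ≠ c → b ≠ d → False := by
  constructor
  · intro h a b c d hab hbc hcd hda hac hbd
    refine h a (.cons hab (.cons hbc (.cons hcd (.cons hda .nil)))) ?_ rfl
    rw [Walk.cons_isCycle_iff]
    have := hab.ne; have := hbc.ne; have := hcd.ne; have := hda.ne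
    constructor
    · simp_all [Walk.isPath_def, eq_comm]
    · simp_all [eq_comm]
  · intro h v w hw hl
    match w, hw, hl with
    | .cons (v := b) hab (.cons (v := c) hbc (.cons (v := d) hcd (.cons hda .nil))), hw, _ =>
      rw [Walk.cons_isCycle_iff] at hw
      have := hw.1.support_nodup
      simp at this
      refine h _ _ _ _ hab hbc hcd hda ?_ ?_
      · rintro rfl
        simp_all
      · rintro rfl
        simp_all

lemma IsLeaf.eq_of_adj {V : Type*} {G : SimpleGraph V} {v x y : V} (h : IsLeaf G v)
    (hx : G.Adj v x) (hy : G.Adj v y) : x = y := by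
  obtain ⟨a, ha⟩ := Set.ncard_eq_one.mp h
  have h1 : x ∈ G.neighborSet v := hx
  have h2 : y ∈ G.neighborSet v := hy
  rw [ha] at h1 h2
  exact h1.trans h2.symm

section Halin

variable {V : Type*} [Fintype V] (H : HalinGraph V)

lemma isLeaf_of_C_adj {x y : V} (h : H.C.Adj x y) : IsLeaf H.T x := by
  have : x ∈ H.C.support := ⟨y, h⟩
  rwa [H.support_C] at this

lemma not_adj_of_isLeaf {x y : V} (hx : IsLeaf H.T x) (hy : IsLeaf H.T y) :
    ¬ H.T.Adj x y := by
  intro h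
  have hsub : ∀ z, H.T.Reachable x z → z = x ∨ z = y := by
    rintro z ⟨w⟩
    suffices ∀ {a b : V} (w : H.T.Walk a b), (a = x ∨ a = y) → (b = x ∨ b = y) from
      this w (.inl rfl)
    intro a b w
    induction w with
    | nil => exact id
    | cons hab _ ih =>
      rintro (rfl | rfl)
      · exact ih (.inr (IsLeaf.eq_of_adj hx hab h))
      · exact ih (.inl (IsLeaf.eq_of_adj hy hab h.symm))
  classical
  have hle : Fintype.card V ≤ #({x, y} : Finset V) := by
    rw [← card_univ]
    refine card_le_card fun z _ => ?_
    simpa using hsub z (H.tree_isTree.connected x z)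
  have := H.four_le_card
  have : #({x, y} : Finset V) ≤ 2 := card_le_two
  omega

open Classical in
lemma two_mul_card_leaves :
    2 * #H.C.edgeFinset = 2 * #{x : V | IsLeaf H.T x} := by
  rw [← sum_degrees_eq_twice_card_edges, mul_comm 2, ← smul_eq_mul, ← sum_const, sum_filter]
  refine sum_congr rfl fun x _ => ?_
  rw [← ncDeg_eq_degree]
  split_ifs with hx
  · exact H.two_regular x (H.support_C ▸ hx)
  · rw [ncDeg, Set.ncard_eq_zero (Set.toFinite _)]
    ext y
    simp only [mem_neighborSet, Set.mem_empty_iff_false, iff_false]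
    exact fun h => hx (isLeaf_of_C_adj H h)

open Classical in
/-- The number of edges of a Halin graph is `(n - 1)` plus the number of leaves. -/
lemma eCount_graph :
    eCount H.graph + 1 = Fintype.card V + #{x : V | IsLeaf H.T x} := by
  have h1 := H.tree_isTree.card_edgeFinset
  have h2 := two_mul_card_leaves H
  have h3 : #(H.T.edgeFinset ∪ H.C.edgeFinset) = #H.T.edgeFinset + #H.C.edgeFinset := by
    refine card_union_of_disjoint (Finset.disjoint_left.mpr fun e => ?_)
    induction e with
    | _ x y =>
      simp only [mem_edgeFinset, mem_edgeSet]
      exact fun hT hC => not_adj_of_isLeaf H (isLeaf_of_C_adj H hC)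
        (isLeaf_of_C_adj H hC.symm) hT
  have h4 : H.graph.edgeFinset = H.T.edgeFinset ∪ H.C.edgeFinset := by
    ext e
    rw [mem_union, mem_edgeFinset, mem_edgeFinset, mem_edgeFinset, HalinGraph.graph, edgeSet_sup]
    rfl
  rw [eCount_eq_card_edgeFinset, h4, h3]
  omega

open Classical in
/-- A set inducing a connected subgraph spans at least `2 (|A| - 1)` ordered adjacent pairs. -/
lemma two_mul_card_le_of_connected (G : SimpleGraph V) (A : Set V) (h : (G.induce A).Connected) :
    2 * #{x : V | x ∈ A} ≤ #{p : V × V | G.Adj p.1 p.2 ∧ p.1 ∈ A ∧ p.2 ∈ A} + 2 := by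
  have h1 := h.card_vert_le_card_edgeSet_add_one
  have h2 := (G.induce A).dart_card_eq_twice_card_edges
  have h3 : Fintype.card (G.induce A).Dart ≤
      #{p : V × V | G.Adj p.1 p.2 ∧ p.1 ∈ A ∧ p.2 ∈ A} := by
    rw [← card_univ]
    refine card_le_card_of_injOn (fun d => (d.fst.1, d.snd.1)) ?_ ?_
    · intro d _
      simpa using d.adj
    · intro d _ e _ hde
      simp only [Prod.mk.injEq] at hde
      exact Dart.ext _ _ (Prod.ext (Subtype.ext hde.1) (Subtype.ext hde.2))
  have h4 : Nat.card A = #{x : V | x ∈ A} := by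
    rw [Nat.card_eq_fintype_card, Fintype.card_subtype]
  rw [Nat.card_eq_fintype_card (α := (G.induce A).edgeSet), ← edgeFinset_card] at h1
  omega

/-- An edge `f` separates `x` from `y` in `G` if deleting it disconnects them. -/
def Separates (G : SimpleGraph V) (f : Sym2 V) (x y : V) : Prop :=
  ¬ (G.deleteEdges {f}).Reachable x y

open Classical in
lemma card_C_adj : #{p : V × V | H.C.Adj p.1 p.2} = 2 * #{x : V | IsLeaf H.T x} := by
  rw [← two_mul_card_leaves, ← sum_degrees_eq_twice_card_edges, card_filter,
    ← univ_product_univ, sum_product]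
  refine sum_congr rfl fun x _ => ?_
  rw [← card_filter, ← card_neighborFinset_eq_degree, neighborFinset_eq_filter]

open Classical in
/-- Every tree edge separates at most two edges of the outer cycle, counted as ordered pairs. -/
lemma card_separated_le {f : Sym2 V} (hf : f ∈ H.T.edgeSet) :
    #{p : V × V | H.C.Adj p.1 p.2 ∧ Separates H.T f p.1 p.2} ≤ 4 := by
  induction f with
  | _ u v =>
  set R := H.T.deleteEdges {s(u, v)} with hR
  have huv : H.T.Adj u v := hf
  have hbr : ¬ R.Reachable u v :=
    isBridge_iff.mp (isAcyclic_iff_forall_adj_isBridge.mp H.tree_isTree.isAcyclic huv)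
  have hcov : ∀ x, R.Reachable u x ∨ R.Reachable v x := by
    intro x
    obtain ⟨w⟩ := H.tree_isTree.connected u x
    suffices ∀ {a b : V} (w : H.T.Walk a b), (R.Reachable u a ∨ R.Reachable v a) →
        (R.Reachable u b ∨ R.Reachable v b) from this w (.inl .rfl)
    intro a b w
    induction w with
    | nil => exact id
    | @cons a b _ hab _ ih =>
      intro ha
      apply ih
      by_cases he : s(a, b) = s(u, v)
      · rcases Sym2.eq_iff.mp he with ⟨rfl, rfl⟩ | ⟨rfl, rfl⟩
        · exact .inr .rfl
        · exact .inl .rfl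
      · have : R.Adj a b := by simp [hR, deleteEdges_adj, hab, he]
        exact ha.imp (·.trans this.reachable) (·.trans this.reachable)
  obtain ⟨A, hA⟩ : ∃ A : Set V, A = {x | IsLeaf H.T x ∧ R.Reachable u x} := ⟨_, rfl⟩
  obtain ⟨B, hB⟩ : ∃ B : Set V, B = {x | IsLeaf H.T x ∧ R.Reachable v x} := ⟨_, rfl⟩
  have h1 := two_mul_card_le_of_connected H.C A (hA ▸ H.planar u v huv)
  have h2 := two_mul_card_le_of_connected H.C B (by
    have := H.planar v u huv.symm
    rwa [Sym2.eq_swap, ← hR, ← hB] at this)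
  have h3 : #{x : V | IsLeaf H.T x} ≤ #{x : V | x ∈ A} + #{x : V | x ∈ B} := by
    rw [← card_union_add_card_inter, ← filter_or]
    refine (card_le_card fun x => ?_).trans (Nat.le_add_right _ _)
    simp only [mem_filter, mem_univ, true_and, hA, hB, Set.mem_ofPred_eq]
    exact fun hx => (hcov x).imp (⟨hx, ·⟩) (⟨hx, ·⟩)
  have h4 := card_C_adj H
  set PA : Finset (V × V) := {p | H.C.Adj p.1 p.2 ∧ p.1 ∈ A ∧ p.2 ∈ A} with hPA
  set PB : Finset (V × V) := {p | H.C.Adj p.1 p.2 ∧ p.1 ∈ B ∧ p.2 ∈ B} with hPB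
  set PS : Finset (V × V) := {p | H.C.Adj p.1 p.2 ∧ Separates H.T s(u, v) p.1 p.2} with hPS
  have hAB : Disjoint PA PB := by
    rw [Finset.disjoint_left]
    rintro ⟨x, y⟩ h5 h6
    simp only [hPA, hPB, hA, hB, mem_filter, mem_univ, true_and, Set.mem_ofPred_eq] at h5 h6
    exact hbr (h5.2.1.2.trans h6.2.1.2.symm)
  have hABS : Disjoint (PA ∪ PB) PS := by
    rw [Finset.disjoint_left]
    rintro ⟨x, y⟩ h5 h6
    simp only [hPA, hPB, hPS, hA, hB, mem_union, mem_filter, mem_univ, true_and,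
      Set.mem_ofPred_eq] at h5 h6
    rcases h5 with h5 | h5
    · exact h6.2 (h5.2.1.2.symm.trans h5.2.2.2)
    · exact h6.2 (h5.2.1.2.symm.trans h5.2.2.2)
  have h5 : #(PA ∪ PB ∪ PS) ≤ #{p : V × V | H.C.Adj p.1 p.2} := by
    refine card_le_card fun p => ?_
    simp only [hPA, hPB, hPS, mem_union, mem_filter, mem_univ, true_and]
    tauto
  rw [card_union_of_disjoint hABS, card_union_of_disjoint hAB] at h5
  omega

open Classical in
/-- All edges of the tree path from `x` to `y` separate `x` from `y`. -/
lemma length_le_card_separates {T : SimpleGraph V} (hT : T.IsAcyclic) {x y : V}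
    (p : T.Walk x y) (hp : p.IsPath) :
    p.length ≤ #{f ∈ T.edgeFinset | Separates T f x y} := by
  rw [← Walk.length_edges, ← List.toFinset_card_of_nodup hp.isTrail.edges_nodup]
  refine card_le_card fun f hf => ?_
  rw [List.mem_toFinset] at hf
  rw [mem_filter, mem_edgeFinset]
  refine ⟨p.edges_subset_edgeSet hf, fun hr => ?_⟩
  obtain ⟨q, hq⟩ := hr.exists_isPath
  have hle : T.deleteEdges {f} ≤ T := deleteEdges_le _
  have huniq := (hT.subsingleton_path x y).elim ⟨p, hp⟩ ⟨q.mapLe hle, hq.mapLe hle⟩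
  have hpq : p = q.mapLe hle := congrArg Subtype.val huniq
  rw [hpq, Walk.edges_mapLe_eq_edges] at hf
  have := q.edges_subset_edgeSet hf
  simp at this

open Classical in
lemma le_card_separates (hC4 : C4Free H.graph) {x y : V} (h : H.C.Adj x y) :
    2 ≤ #{f ∈ H.T.edgeFinset | Separates H.T f x y} ∧
      ((¬ ∃ p, H.T.Adj p x ∧ H.T.Adj p y) →
        4 ≤ #{f ∈ H.T.edgeFinset | Separates H.T f x y}) := by
  obtain ⟨p, hp⟩ := (H.tree_isTree.connected x y).exists_isPath
  have hlen := length_le_card_separates H.tree_isTree.isAcyclic p hp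
  have hx := isLeaf_of_C_adj H h
  have hy := isLeaf_of_C_adj H h.symm
  have hT : H.T ≤ H.graph := le_sup_left
  have hC : H.C ≤ H.graph := le_sup_right
  have hcases : p.length = 2 ∧ (∃ p, H.T.Adj p x ∧ H.T.Adj p y) ∨ 4 ≤ p.length := by
    match p, hp with
    | .nil, _ => exact (h.ne rfl).elim
    | .cons h1 .nil, _ => exact (not_adj_of_isLeaf H hx hy h1).elim
    | .cons (v := a) h1 (.cons h2 .nil), _ => exact .inl ⟨rfl, a, h1.symm, h2⟩
    | .cons (v := a) h1 (.cons (v := b) h2 (.cons h3 .nil)), hp =>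
      refine ((c4Free_iff _).mp hC4 x a b y (hT h1) (hT h2) (hT h3) (hC h.symm) ?_ ?_).elim
      · rintro rfl
        simp [Walk.isPath_def] at hp
      · rintro rfl
        simp [Walk.isPath_def] at hp
    | .cons _ (.cons _ (.cons _ (.cons _ p))), _ =>
      right
      simp only [Walk.length_cons]
      omega
  rcases hcases with ⟨h1, h2⟩ | h1
  · exact ⟨by omega, fun h => (h h2).elim⟩
  · exact ⟨by omega, fun _ => by omega⟩

open Classical in
/-- The tree distances from a leaf to its two neighbours on the cycle sum to at least six. -/
lemma six_le_sum_card_separates (hC4 : C4Free H.graph) {x : V} (hx : IsLeaf H.T x) :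
    6 ≤ ∑ y ∈ ({y | H.C.Adj x y} : Finset V), #{f ∈ H.T.edgeFinset | Separates H.T f x y} := by
  obtain ⟨y, z, hyz, hN⟩ := Set.ncard_eq_two.mp (H.two_regular x (H.support_C ▸ hx))
  have hy : H.C.Adj x y := by
    rw [← mem_neighborSet, hN]
    simp
  have hz : H.C.Adj x z := by
    rw [← mem_neighborSet, hN]
    simp
  have hset : ({y | H.C.Adj x y} : Finset V) = {y, z} := by
    ext w
    rw [mem_filter, ← mem_neighborSet, hN]
    simp
  rw [hset, sum_pair hyz]
  have h1 := le_card_separates H hC4 hy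
  have h2 := le_card_separates H hC4 hz
  have h3 : ¬ ((∃ p, H.T.Adj p x ∧ H.T.Adj p y) ∧ ∃ p, H.T.Adj p x ∧ H.T.Adj p z) := by
    rintro ⟨⟨p, hpx, hpy⟩, q, hqx, hqz⟩
    obtain rfl := IsLeaf.eq_of_adj hx hpx.symm hqx.symm
    have hT : H.T ≤ H.graph := le_sup_left
    have hC : H.C ≤ H.graph := le_sup_right
    exact (c4Free_iff _).mp hC4 p y x z (hT hpy) (hC hy.symm) (hC hz) (hT hqz.symm) hpx.ne hyz
  by_cases h4 : ∃ p, H.T.Adj p x ∧ H.T.Adj p y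
  · have := h2.2 fun h5 => h3 ⟨h4, h5⟩
    omega
  · have := h1.2 h4
    omega

open Classical in
/-- A `C₄`-free Halin graph on `n` vertices has at most `2 (n - 1) / 3` leaves. -/
lemma three_mul_card_leaves_le (hC4 : C4Free H.graph) :
    3 * #{x : V | IsLeaf H.T x} + 2 ≤ 2 * Fintype.card V := by
  have h1 : 6 * #{x : V | IsLeaf H.T x} ≤
      ∑ x : V, ∑ y ∈ ({y | H.C.Adj x y} : Finset V),
        #{f ∈ H.T.edgeFinset | Separates H.T f x y} := by
    rw [mul_comm, ← smul_eq_mul, ← sum_const]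
    refine (sum_le_sum fun x hx => six_le_sum_card_separates H hC4 (mem_filter.mp hx).2).trans ?_
    exact sum_le_sum_of_subset (filter_subset _ _)
  have h2 : ∑ x : V, ∑ y ∈ ({y | H.C.Adj x y} : Finset V),
        #{f ∈ H.T.edgeFinset | Separates H.T f x y} =
      ∑ f ∈ H.T.edgeFinset, #{p : V × V | H.C.Adj p.1 p.2 ∧ Separates H.T f p.1 p.2} := by
    simp_rw [card_filter]
    rw [sum_comm, ← univ_product_univ, sum_product]
    refine sum_congr rfl fun x _ => ?_
    rw [sum_filter]
    refine sum_congr rfl fun y _ => ?_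
    split_ifs with h <;> simp [h]
  have h3 : ∑ f ∈ H.T.edgeFinset, #{p : V × V | H.C.Adj p.1 p.2 ∧ Separates H.T f p.1 p.2} ≤
      #H.T.edgeFinset * 4 :=
    sum_le_card_nsmul _ _ _ fun f hf => card_separated_le H (mem_edgeFinset.mp hf)
  have h4 := H.tree_isTree.card_edgeFinset
  omega

end Halin

section Construction

lemma reachable_of_rank {V : Type*} {G : SimpleGraph V} (P : V → Prop) (r : V) (f : V → ℕ)
    (step : ∀ x, P x → x ≠ r → ∃ y, G.Adj x y ∧ P y ∧ f y < f x) {x : V} (hx : P x) :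
    G.Reachable x r := by
  induction h : f x using Nat.strong_induction_on generalizing x with
  | _ k ih =>
    by_cases hr : x = r
    · rw [hr]
    · obtain ⟨y, hxy, hy, hlt⟩ := step x hx hr
      exact hxy.reachable.trans (ih (f y) (h ▸ hlt) hy rfl)

lemma connected_of_rank {V : Type*} {G : SimpleGraph V} (r : V) (f : V → ℕ)
    (step : ∀ x, x ≠ r → ∃ y, G.Adj x y ∧ f y < f x) : G.Connected := by
  have key (x : V) : G.Reachable x r :=
    reachable_of_rank (fun _ => True) r f (fun x _ hx => by simpa using step x hx) trivial
  exact { preconnected := fun x y => (key x).trans (key y).symm, nonempty := ⟨r⟩ }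

lemma reachable_invariant {V : Type*} {G : SimpleGraph V} (P : V → Prop)
    (step : ∀ x y, G.Adj x y → P x → P y) {x y : V} (h : G.Reachable x y) (hx : P x) : P y := by
  obtain ⟨w⟩ := h
  induction w with
  | nil => exact hx
  | cons hab _ ih => exact ih (step _ _ hab hx)

/-- The graph on `Fin n` joining every vertex `x` to `par x` whenever `x < par x`. -/
def parentGraph (n : ℕ) (par : ℕ → ℕ) : SimpleGraph (Fin n) where
  Adj x y := (x.1 < y.1 ∧ y.1 = par x) ∨ (y.1 < x.1 ∧ x.1 = par y)
  symm := ⟨fun _ _ h => h.symm⟩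
  loopless := ⟨fun _ h => by omega⟩

/-- Cyclic successor on `{0, …, L - 1}`. -/
def cyclicSucc (L x : ℕ) : ℕ := if x + 1 = L then 0 else x + 1

/-- The cycle `0, 1, …, L - 1` as a graph on `Fin n`. -/
def initialCycle (n L : ℕ) : SimpleGraph (Fin n) where
  Adj x y := x.1 < L ∧ y.1 < L ∧ x.1 ≠ y.1 ∧ (y.1 = cyclicSucc L x ∨ x.1 = cyclicSucc L y)
  symm := ⟨fun _ _ h => ⟨h.2.1, h.1, h.2.2.1.symm, h.2.2.2.symm⟩⟩
  loopless := ⟨fun _ h => h.2.2.1 rfl⟩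

lemma initialCycle_arc_connected {n L a b : ℕ} (hab : a < b) (hb : b ≤ L) (hL : L ≤ n)
    (S : Set (Fin n)) (hS : ∀ x, x ∈ S ↔ a ≤ x.1 ∧ x.1 < b) :
    ((initialCycle n L).induce S).Connected := by
  refine connected_of_rank ⟨⟨a, by omega⟩, (hS _).mpr ⟨le_rfl, hab⟩⟩ (fun x => x.1.1) ?_
  rintro ⟨x, hx⟩ hne
  have hx' := (hS x).mp hx
  have hne' : x.1 ≠ a := fun h => hne (Subtype.ext (Fin.ext h))
  refine ⟨⟨⟨x.1 - 1, by omega⟩, (hS _).mpr ?_⟩, ?_, ?_⟩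
  · simp only
    omega
  · refine ⟨by simp only [Function.Embedding.subtype_apply]; omega,
      by simp only [Function.Embedding.subtype_apply]; omega,
      by simp only [Function.Embedding.subtype_apply]; omega, .inr ?_⟩
    have h : x.1 - 1 + 1 = x.1 := by omega
    simp only [Function.Embedding.subtype_apply, cyclicSucc, h]
    rw [if_neg (by omega)]
  · simp only
    omega

lemma initialCycle_compl_arc_connected {n L a b : ℕ} (hab : a < b) (hb : b ≤ L) (hL : L ≤ n)
    (hne : 0 < a ∨ b < L) (S : Set (Fin n))
    (hS : ∀ x, x ∈ S ↔ x.1 < L ∧ ¬ (a ≤ x.1 ∧ x.1 < b)) :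
    ((initialCycle n L).induce S).Connected := by
  refine connected_of_rank ⟨⟨if b < L then b else 0, ?_⟩, (hS _).mpr ?_⟩
    (fun x => if b ≤ x.1.1 then x.1.1 - b else x.1.1 + L - b) ?_
  · split_ifs <;> omega
  · simp only
    split_ifs <;> omega
  rintro ⟨x, hx⟩ hne
  have hx' := (hS x).mp hx
  have hne' : x.1 ≠ if b < L then b else 0 := fun h => hne (Subtype.ext (Fin.ext h))
  refine ⟨⟨⟨if x.1 = 0 then L - 1 else x.1 - 1, ?_⟩, (hS _).mpr ?_⟩, ?_, ?_⟩
  · split_ifs <;> omega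
  · simp only
    split_ifs at * <;> omega
  · refine ⟨hx'.1, ?_, ?_, .inr ?_⟩ <;>
    · simp only [Function.Embedding.subtype_apply, cyclicSucc]
      split_ifs at * <;> omega
  · simp only
    split_ifs at * <;> omega

/-- Combinatorial data for a Halin graph on `{0, …, n - 1}` with leaves `0, …, L - 1` in cyclic
order and root `n - 1`: the leaves below `v` form the interval `[lo v, hi v)`. The last three
fields exclude four-cycles. -/
structure IsHalinData (n L : ℕ) (par lo hi : ℕ → ℕ) : Prop where
  five_le : 5 ≤ L
  lt_card : L < n
  lt_par : ∀ v, v + 1 < n → v < par v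
  par_lt : ∀ v, v + 1 < n → par v < n
  le_par : ∀ v, v + 1 < n → L ≤ par v
  children : ∀ v, L ≤ v → v < n → ∃ a b, a < b ∧ b < v ∧ par a = v ∧ par b = v
  root_children : ∃ a b c, a < b ∧ b < c ∧ c + 1 < n ∧
    par a + 1 = n ∧ par b + 1 = n ∧ par c + 1 = n
  lo_leaf : ∀ x, x < L → lo x = x
  hi_leaf : ∀ x, x < L → hi x = x + 1
  nested : ∀ v, v + 1 < n → lo (par v) ≤ lo v ∧ hi v ≤ hi (par v)
  lo_lt_hi : ∀ v, v + 1 < n → lo v < hi v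
  hi_le : ∀ v, v + 1 < n → hi v ≤ L
  proper : ∀ v, v + 1 < n → 0 < lo v ∨ hi v < L
  laminar : ∀ y v, y < v → v + 1 < n → lo v ≤ lo y → hi y ≤ hi v →
    par y ≤ v ∧ lo v ≤ lo (par y) ∧ hi (par y) ≤ hi v
  par_par_ne : ∀ x, x < L → par x + 1 < n → par (par x) ≠ par (cyclicSucc L x)
  par_ne_par_par : ∀ x, x < L → par (cyclicSucc L x) + 1 < n →
    par x ≠ par (par (cyclicSucc L x))
  par_ne_par : ∀ x, x < L → par x ≠ par (cyclicSucc L (cyclicSucc L x))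

namespace IsHalinData

variable {n L : ℕ} {par lo hi : ℕ → ℕ}

lemma exists_parent (D : IsHalinData n L par lo hi) (x : Fin n) (hx : x.1 + 1 < n) :
    ∃ p : Fin n, p.1 = par x ∧ (parentGraph n par).Adj x p ∧ x.1 < p.1 :=
  ⟨⟨par x, D.par_lt x hx⟩, rfl, .inl ⟨D.lt_par x hx, rfl⟩, D.lt_par x hx⟩

lemma isTree (D : IsHalinData n L par lo hi) : (parentGraph n par).IsTree := by
  classical
  have hn := D.lt_card
  have hc : (parentGraph n par).Connected := by
    refine connected_of_rank ⟨n - 1, by omega⟩ (fun x => n - x.1) fun x hx => ?_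
    have : x.1 ≠ n - 1 := fun h => hx (Fin.ext h)
    obtain ⟨p, _, hp, hlt⟩ := D.exists_parent x (by omega)
    exact ⟨p, hp, by omega⟩
  refine isTree_iff_connected_and_card.mpr ⟨hc, le_antisymm ?_ hc.card_vert_le_card_edgeSet_add_one⟩
  have key : (parentGraph n par).edgeFinset ⊆
      ({x : Fin n | x ≠ ⟨n - 1, by omega⟩} : Finset (Fin n)).image
        fun x => s(x, if h : par x < n then ⟨par x, h⟩ else x) := by
    intro e
    induction e with
    | _ x y =>
      simp only [mem_edgeFinset, mem_edgeSet, mem_image, mem_filter, mem_univ, true_and, ne_eq,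
        Fin.ext_iff]
      rintro (⟨h1, h2⟩ | ⟨h1, h2⟩)
      · refine ⟨x, by omega, ?_⟩
        rw [dif_pos (by omega)]
        congr 1
        simp [← h2]
      · refine ⟨y, by omega, ?_⟩
        rw [dif_pos (by omega), Sym2.eq_swap]
        congr 1
        simp [← h2]
  have hle := (card_le_card key).trans card_image_le
  rw [filter_ne', card_erase_of_mem (mem_univ _), card_univ, Fintype.card_fin] at hle
  rw [Nat.card_eq_fintype_card, ← edgeFinset_card, Nat.card_eq_fintype_card, Fintype.card_fin]
  omega

lemma isLeaf_iff (D : IsHalinData n L par lo hi)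
    (x : Fin n) : IsLeaf (parentGraph n par) x ↔ x.1 < L := by
  have hn := D.lt_card
  constructor
  · intro h
    by_contra hx
    obtain ⟨a, b, hab, hb, ha', hb'⟩ := D.children x (by omega) x.2
    have h1 : (parentGraph n par).Adj x ⟨a, by omega⟩ := .inr ⟨by simp only; omega, ha'.symm⟩
    have h2 : (parentGraph n par).Adj x ⟨b, by omega⟩ := .inr ⟨by simp only; omega, hb'.symm⟩
    have := Fin.ext_iff.mp (IsLeaf.eq_of_adj h h1 h2)
    simp only at this
    omega
  · intro hx
    obtain ⟨p, hp, hadj, _⟩ := D.exists_parent x (by omega)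
    refine Set.ncard_eq_one.mpr ⟨p, ?_⟩
    ext y
    rw [mem_neighborSet, Set.mem_singleton_iff]
    constructor
    · rintro (⟨_, h⟩ | ⟨h1, h2⟩)
      · exact Fin.ext (h.trans hp.symm)
      · have := D.le_par y (by omega)
        omega
    · rintro rfl
      exact hadj

lemma three_le_ncDeg (D : IsHalinData n L par lo hi)
    (x : Fin n) (hx : L ≤ x.1) : 3 ≤ ncDeg (parentGraph n par) x := by
  have key : ∀ a b c : Fin n, a ≠ b → a ≠ c → b ≠ c → (parentGraph n par).Adj x a →
      (parentGraph n par).Adj x b → (parentGraph n par).Adj x c →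
      3 ≤ ncDeg (parentGraph n par) x := by
    intro a b c hab hac hbc ha hb hc
    rw [← Set.ncard_eq_three.mpr ⟨a, b, c, hab, hac, hbc, rfl⟩]
    refine Set.ncard_le_ncard ?_ (Set.toFinite _)
    rintro y (rfl | rfl | rfl) <;> assumption
  by_cases hr : x.1 + 1 = n
  · obtain ⟨a, b, c, hab, hbc, hc, ha', hb', hc'⟩ := D.root_children
    refine key ⟨a, by omega⟩ ⟨b, by omega⟩ ⟨c, by omega⟩ ?_ ?_ ?_
      (.inr ⟨by simp only; omega, by simp only; omega⟩)
      (.inr ⟨by simp only; omega, by simp only; omega⟩)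
      (.inr ⟨by simp only; omega, by simp only; omega⟩) <;>
    · rw [ne_eq, Fin.ext_iff]
      simp only
      omega
  · obtain ⟨a, b, hab, hb, ha', hb'⟩ := D.children x hx x.2
    obtain ⟨p, hp, hadj, hlt⟩ := D.exists_parent x (by omega)
    refine key ⟨a, by omega⟩ ⟨b, by omega⟩ p ?_ ?_ ?_
      (.inr ⟨by simp only; omega, by simp only; omega⟩)
      (.inr ⟨by simp only; omega, by simp only; omega⟩) hadj <;>
    · rw [ne_eq, Fin.ext_iff]
      simp only
      omega

lemma initialCycle_support (D : IsHalinData n L par lo hi) :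
    (initialCycle n L).support = {x | IsLeaf (parentGraph n par) x} := by
  have hn := D.lt_card
  have h5 := D.five_le
  ext x
  rw [mem_support, Set.mem_ofPred_eq, D.isLeaf_iff]
  refine ⟨fun ⟨_, h⟩ => h.1, fun hx => ?_⟩
  refine ⟨⟨cyclicSucc L x, ?_⟩, hx, ?_, ?_, .inl rfl⟩ <;>
  · simp only [cyclicSucc]
    split_ifs <;> omega

lemma initialCycle_ncDeg (D : IsHalinData n L par lo hi)
    (x : Fin n) (hx : x.1 < L) : ncDeg (initialCycle n L) x = 2 := by
  have hn := D.lt_card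
  have h5 := D.five_le
  refine Set.ncard_eq_two.mpr ⟨⟨if x.1 + 1 = L then 0 else x.1 + 1, by split_ifs <;> omega⟩,
    ⟨if x.1 = 0 then L - 1 else x.1 - 1, by split_ifs <;> omega⟩, ?_, ?_⟩
  · rw [ne_eq, Fin.ext_iff]
    simp only
    split_ifs <;> omega
  · ext y
    simp only [mem_neighborSet, Set.mem_insert_iff, Set.mem_singleton_iff, Fin.ext_iff,
      initialCycle, cyclicSucc]
    split_ifs <;> omega

/-- Deleting the edge from `v` to its parent leaves the subtree below `v` and its complement. -/
lemma below_iff_reachable (D : IsHalinData n L par lo hi)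
    (v p : Fin n) (hv : v.1 + 1 < n) (hp : p.1 = par v) (x : Fin n) :
    (((parentGraph n par).deleteEdges {s(v, p)}).Reachable v x ↔
      lo v ≤ lo x ∧ hi x ≤ hi v ∧ x.1 ≤ v) ∧
    (((parentGraph n par).deleteEdges {s(v, p)}).Reachable p x ↔
      ¬ (lo v ≤ lo x ∧ hi x ≤ hi v ∧ x.1 ≤ v)) := by
  have hn := D.lt_card
  set G := (parentGraph n par).deleteEdges {s(v, p)} with hG
  set P : Fin n → Prop := fun x => lo v ≤ lo x ∧ hi x ≤ hi v ∧ x.1 ≤ v with hP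
  have hvp := D.lt_par v hv
  have hup : ∀ y q : Fin n, y.1 < q.1 → q.1 = par y → y ≠ v → (P y ↔ P q) := by
    intro y q hyq hq hyv
    have hyv' : y.1 ≠ v.1 := fun h => hyv (Fin.ext h)
    simp only [hP]
    have h1 := D.nested y (by omega)
    rw [← hq] at h1
    constructor
    · rintro ⟨h2, h3, h4⟩
      have := D.laminar y v (by omega) hv h2 h3
      rw [← hq] at this
      tauto
    · rintro ⟨h2, h3, h4⟩
      exact ⟨by omega, by omega, by omega⟩
  have hadj : ∀ y z : Fin n, G.Adj y z → (P y ↔ P z) := by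
    intro y z hyz
    rw [hG, deleteEdges_adj] at hyz
    obtain ⟨h1 | h1, h2⟩ := hyz
    · refine hup y z h1.1 h1.2 ?_
      rintro rfl
      refine h2 ?_
      rw [Set.mem_singleton_iff, show z = p from Fin.ext (by omega)]
    · refine (hup z y h1.1 h1.2 ?_).symm
      rintro rfl
      refine h2 ?_
      rw [Set.mem_singleton_iff, show y = p from Fin.ext (by omega), Sym2.eq_swap]
  have hstep : ∀ y : Fin n, y.1 + 1 < n → y ≠ v → ∃ q, G.Adj y q ∧ (P y ↔ P q) ∧
      n - q.1 < n - y.1 := by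
    intro y hy hyv
    obtain ⟨q, hq, hyq, hlt⟩ := D.exists_parent y hy
    refine ⟨q, ?_, hup y q hlt hq hyv, by omega⟩
    rw [hG, deleteEdges_adj]
    refine ⟨hyq, fun h => ?_⟩
    rcases Sym2.eq_iff.mp h with ⟨h1, _⟩ | ⟨h1, h2⟩
    · exact hyv h1
    · rw [h1, h2] at hlt
      omega
  have hin : ∀ y, P y → G.Reachable y v := fun y hy =>
    reachable_of_rank P v (fun x => n - x.1) (fun z hz hzv => by
      obtain ⟨q, h1, h2, h3⟩ := hstep z (by have := hz.2.2; omega) hzv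
      exact ⟨q, h1, h2.mp hz, h3⟩) hy
  have hPv : P v := ⟨le_rfl, le_rfl, le_rfl⟩
  have hPp : ¬ P p := fun h => by
    have := h.2.2
    omega
  have hout : ∀ y, ¬ P y → G.Reachable y ⟨n - 1, by omega⟩ := fun y hy =>
    reachable_of_rank (fun z => ¬ P z) _ (fun x => n - x.1) (fun z hz hzr => by
      have : z.1 ≠ n - 1 := fun h => hzr (Fin.ext h)
      obtain ⟨q, h1, h2, h3⟩ := hstep z (by omega) (by rintro rfl; exact hz hPv)
      exact ⟨q, h1, fun h => hz (h2.mpr h), h3⟩) hy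
  refine ⟨⟨fun h => ?_, fun h => (hin x h).symm⟩, ⟨fun h => ?_, fun h => ?_⟩⟩
  · exact reachable_invariant P (fun y z hyz => (hadj y z hyz).mp) h hPv
  · exact reachable_invariant (fun z => ¬ P z) (fun y z hyz hy hz => hy ((hadj y z hyz).mpr hz))
      h hPp
  · exact (hout p hPp).trans (hout x h).symm

lemma planar_edge (D : IsHalinData n L par lo hi)
    (v p : Fin n) (hv : v.1 + 1 < n) (hp : p.1 = par v) :
    ((initialCycle n L).induce {x | IsLeaf (parentGraph n par) x ∧
      ((parentGraph n par).deleteEdges {s(v, p)}).Reachable v x}).Connected ∧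
    ((initialCycle n L).induce {x | IsLeaf (parentGraph n par) x ∧
      ((parentGraph n par).deleteEdges {s(v, p)}).Reachable p x}).Connected := by
  have hn := D.lt_card
  have h1 := D.lo_lt_hi v hv
  have h2 := D.hi_le v hv
  have hleaf : ∀ x : Fin n, x.1 < L →
      ((lo v ≤ lo x ∧ hi x ≤ hi v ∧ x.1 ≤ v) ↔ lo v ≤ x.1 ∧ x.1 < hi v) := by
    intro x hx
    rw [D.lo_leaf x hx, D.hi_leaf x hx]
    by_cases hvL : v.1 < L
    · rw [D.lo_leaf v hvL, D.hi_leaf v hvL]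
      omega
    · omega
  constructor
  · refine initialCycle_arc_connected h1 h2 hn.le _ fun x => ?_
    rw [Set.mem_ofPred_eq, D.isLeaf_iff, (D.below_iff_reachable v p hv hp x).1]
    constructor
    · exact fun h => (hleaf x h.1).mp h.2
    · exact fun h => ⟨by omega, (hleaf x (by omega)).mpr h⟩
  · refine initialCycle_compl_arc_connected h1 h2 hn.le (D.proper v hv) _ fun x => ?_
    rw [Set.mem_ofPred_eq, D.isLeaf_iff, (D.below_iff_reachable v p hv hp x).2]
    exact and_congr_right fun hx => not_congr (hleaf x hx)

/-- The Halin graph described by combinatorial data. -/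
def toHalinGraph (D : IsHalinData n L par lo hi) : HalinGraph (Fin n) where
  T := parentGraph n par
  C := initialCycle n L
  tree_isTree := D.isTree
  four_le_card := by
    have := D.lt_card
    have := D.five_le
    rw [Fintype.card_fin]
    omega
  nonleaf_degree v hv := D.three_le_ncDeg v (by rwa [D.isLeaf_iff, not_lt] at hv)
  support_C := D.initialCycle_support
  two_regular v hv := D.initialCycle_ncDeg v (by
    rwa [D.initialCycle_support, Set.mem_ofPred_eq, D.isLeaf_iff] at hv)
  cycle_connected := by
    have := D.five_le
    refine initialCycle_arc_connected (a := 0) (by omega) le_rfl D.lt_card.le _ fun x => ?_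
    rw [D.initialCycle_support, Set.mem_ofPred_eq, D.isLeaf_iff]
    omega
  planar u v huv := by
    rcases huv with ⟨h1, h2⟩ | ⟨h1, h2⟩
    · exact (D.planar_edge u v (by omega) h2).1
    · rw [Sym2.eq_swap]
      exact (D.planar_edge v u (by omega) h2).2

lemma no_four_cycle_of_cycle_edge (D : IsHalinData n L par lo hi)
    (a b c d : Fin n) (hab : b.1 = cyclicSucc L a)
    (haL : a.1 < L) (hbL : b.1 < L)
    (hbc : D.toHalinGraph.graph.Adj b c) (hcd : D.toHalinGraph.graph.Adj c d)
    (hda : D.toHalinGraph.graph.Adj d a) (hac : a ≠ c) (hbd : b ≠ d) : False := by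
  have hn := D.lt_card
  have h5 := D.five_le
  have hTleaf : ∀ x y : Fin n, x.1 < L → (parentGraph n par).Adj x y → y.1 = par x ∧ L ≤ y.1 := by
    intro x y hx hxy
    rcases hxy with ⟨_, h⟩ | ⟨h1, h2⟩
    · have := D.le_par x (by omega)
      omega
    · have := D.le_par y (by omega)
      omega
  have hac' : a.1 ≠ c.1 := fun h => hac (Fin.ext h)
  have hbd' : b.1 ≠ d.1 := fun h => hbd (Fin.ext h)
  have hstep : c.1 < L → (initialCycle n L).Adj b c → c.1 = cyclicSucc L b := by
    intro _ h
    rcases h.2.2.2 with h1 | h1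
    · exact h1
    · simp only [cyclicSucc] at h1 hab
      split_ifs at h1 hab <;> omega
  have hstep' : d.1 < L → (initialCycle n L).Adj d a → a.1 = cyclicSucc L d := by
    intro _ h
    rcases h.2.2.2 with h1 | h1
    · exact h1
    · simp only [cyclicSucc] at h1 hab
      split_ifs at h1 hab <;> omega
  rcases hbc with hbc | hbc <;> rcases hda with hda | hda
  · obtain ⟨hc, hcL⟩ := hTleaf b c hbL hbc
    obtain ⟨hd, hdL⟩ := hTleaf a d haL hda.symm
    rcases hcd with (⟨h1, h2⟩ | ⟨h1, h2⟩) | hcd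
    · refine D.par_ne_par_par a haL ?_ ?_ <;> rw [← hab, ← hc]
      · omega
      · rw [← hd, h2]
    · refine D.par_par_ne a haL ?_ ?_ <;> rw [← hd]
      · omega
      · rw [← hab, ← hc, h2]
    · have := hcd.1
      omega
  · obtain ⟨hc, hcL⟩ := hTleaf b c hbL hbc
    have hdL : d.1 < L := hda.1
    rcases hcd with hcd | hcd
    · refine D.par_ne_par d hdL ?_
      rw [← hstep' hdL hda, ← hab, ← hc, ← (hTleaf d c hdL hcd.symm).1]
    · have := hcd.1
      omega
  · obtain ⟨hd, hdL⟩ := hTleaf a d haL hda.symm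
    have hcL : c.1 < L := hbc.2.1
    rcases hcd with hcd | hcd
    · refine D.par_ne_par a haL ?_
      rw [← hab, ← hstep hcL hbc, ← hd, ← (hTleaf c d hcL hcd).1]
    · have := hcd.2.1
      omega
  · have hcL : c.1 < L := hbc.2.1
    have hdL : d.1 < L := hda.1
    have h1 := hstep hcL hbc
    have h2 := hstep' hdL hda
    rcases hcd with hcd | hcd
    · have := (hTleaf c d hcL hcd).2
      omega
    · have h3 := hcd.2.2.2
      simp only [cyclicSucc] at h1 h2 h3 hab
      split_ifs at h1 h2 h3 hab <;> omega

lemma c4Free_graph (D : IsHalinData n L par lo hi) : C4Free D.toHalinGraph.graph := by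
  have key : ∀ a b c d : Fin n, (initialCycle n L).Adj a b → D.toHalinGraph.graph.Adj b c →
      D.toHalinGraph.graph.Adj c d → D.toHalinGraph.graph.Adj d a → a ≠ c → b ≠ d → False := by
    intro a b c d hab hbc hcd hda hac hbd
    rcases hab.2.2.2 with h | h
    · exact D.no_four_cycle_of_cycle_edge a b c d h hab.1 hab.2.1 hbc hcd hda hac hbd
    · exact D.no_four_cycle_of_cycle_edge b a d c h hab.2.1 hab.1 hda.symm hcd.symm hbc.symm
        hbd hac
  have hT : C4Free (parentGraph n par) := fun v w hw => (D.isTree.isAcyclic w hw).elim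
  rw [c4Free_iff] at hT ⊢
  intro a b c d hab hbc hcd hda hac hbd
  rcases id hab with hab' | hab'
  · rcases id hbc with hbc' | hbc'
    · rcases id hcd with hcd' | hcd'
      · rcases id hda with hda' | hda'
        · exact hT a b c d hab' hbc' hcd' hda' hac hbd
        · exact key d a b c hda' hab hbc hcd hbd.symm hac
      · exact key c d a b hcd' hda hab hbc hac.symm hbd.symm
    · exact key b c d a hbc' hcd hda hab hbd hac.symm
  · exact key a b c d hab' hbc hcd hda hac hbd

lemma eCount_toHalinGraph (D : IsHalinData n L par lo hi) :
    eCount D.toHalinGraph.graph + 1 = n + L := by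
  classical
  have h1 := HalinTuran.eCount_graph D.toHalinGraph
  have h2 : ({x : Fin n | IsLeaf D.toHalinGraph.T x} : Finset (Fin n)) =
      ({x : Fin n | x.1 < L} : Finset (Fin n)) :=
    filter_congr fun x _ => D.isLeaf_iff x
  have h3 : #({x : Fin n | x.1 < L} : Finset (Fin n)) = L := by
    rw [Fin.card_filter_val_lt, min_eq_right D.lt_card.le]
  rw [Fintype.card_fin] at h1
  have h4 : #({x : Fin n | IsLeaf D.toHalinGraph.T x} : Finset (Fin n)) = L :=
    (congrArg card h2).trans h3
  convert h1
  exact h4.symm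

end IsHalinData

end Construction

/-- A hub with `k` children, each having two leaf children. -/
lemma isHalinData_spider {k : ℕ} (hk : 3 ≤ k) :
    IsHalinData (3 * k + 1) (2 * k) (fun v => if v < 2 * k then 2 * k + v / 2 else 3 * k)
      (fun v => if v < 2 * k then v else if v < 3 * k then 2 * (v - 2 * k) else 0)
      (fun v => if v < 2 * k then v + 1 else if v < 3 * k then 2 * (v - 2 * k) + 2 else 2 * k) where
  five_le := by omega
  lt_card := by omega
  lt_par v hv := by grind
  par_lt v hv := by grind
  le_par v hv := by grind
  children v hv hv' := by
    by_cases h : v < 3 * k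
    · exact ⟨2 * (v - 2 * k), 2 * (v - 2 * k) + 1, by grind⟩
    · exact ⟨2 * k, 2 * k + 1, by grind⟩
  root_children := ⟨2 * k, 2 * k + 1, 2 * k + 2, by grind⟩
  lo_leaf x hx := by grind
  hi_leaf x hx := by grind
  nested v hv := by grind
  lo_lt_hi v hv := by grind
  hi_le v hv := by grind
  proper v hv := by grind
  laminar y v hyv hv h1 h2 := by grind
  par_par_ne x hx h := by grind [cyclicSucc]
  par_ne_par_par x hx h := by grind [cyclicSucc]
  par_ne_par x hx := by grind [cyclicSucc]

/-- Parent function of a root with two inner children, one carrying `m` pairs of leaves and the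
other two pairs, and with `1 + (ε + 1)` leaf children separating these two branches. -/
def doubleParent (m ε v : ℕ) : ℕ :=
  if v < 2 * m then 2 * m + 6 + ε + v / 2
  else if v = 2 * m then 3 * m + 10 + ε
  else if v < 2 * m + 5 then 2 * m + 6 + ε + (v - 1) / 2
  else if v < 2 * m + 6 + ε then 3 * m + 10 + ε
  else if v < 3 * m + 6 + ε then 3 * m + 8 + ε
  else if v < 3 * m + 8 + ε then 3 * m + 9 + ε
  else 3 * m + 10 + ε

/-- First leaf below each vertex of the tree given by `doubleParent`. -/
def doubleLo (m ε v : ℕ) : ℕ :=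
  if v < 2 * m + 6 + ε then v
  else if v < 3 * m + 6 + ε then 2 * (v - (2 * m + 6 + ε))
  else if v < 3 * m + 8 + ε then 2 * (v - (2 * m + 6 + ε)) + 1
  else if v = 3 * m + 8 + ε then 0
  else if v = 3 * m + 9 + ε then 2 * m + 1
  else 0

/-- Successor of the last leaf below each vertex of the tree given by `doubleParent`. -/
def doubleHi (m ε v : ℕ) : ℕ :=
  if v < 2 * m + 6 + ε then v + 1
  else if v < 3 * m + 6 + ε then 2 * (v - (2 * m + 6 + ε)) + 2
  else if v < 3 * m + 8 + ε then 2 * (v - (2 * m + 6 + ε)) + 3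
  else if v = 3 * m + 8 + ε then 2 * m
  else if v = 3 * m + 9 + ε then 2 * m + 5
  else 2 * m + 6 + ε

lemma doubleParent_spec (m ε v : ℕ) :
    (v < 2 * m ∧ doubleParent m ε v = 2 * m + 6 + ε + v / 2) ∨
    (v = 2 * m ∧ doubleParent m ε v = 3 * m + 10 + ε) ∨
    (2 * m < v ∧ v < 2 * m + 5 ∧ doubleParent m ε v = 2 * m + 6 + ε + (v - 1) / 2) ∨
    (2 * m + 5 ≤ v ∧ v < 2 * m + 6 + ε ∧ doubleParent m ε v = 3 * m + 10 + ε) ∨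
    (2 * m + 6 + ε ≤ v ∧ v < 3 * m + 6 + ε ∧ doubleParent m ε v = 3 * m + 8 + ε) ∨
    (3 * m + 6 + ε ≤ v ∧ v < 3 * m + 8 + ε ∧ doubleParent m ε v = 3 * m + 9 + ε) ∨
    (3 * m + 8 + ε ≤ v ∧ doubleParent m ε v = 3 * m + 10 + ε) := by
  unfold doubleParent
  split_ifs <;> omega

lemma doubleLo_doubleHi_spec (m ε v : ℕ) :
    (v < 2 * m + 6 + ε ∧ doubleLo m ε v = v ∧ doubleHi m ε v = v + 1) ∨
    (2 * m + 6 + ε ≤ v ∧ v < 3 * m + 6 + ε ∧ doubleLo m ε v = 2 * (v - (2 * m + 6 + ε)) ∧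
      doubleHi m ε v = 2 * (v - (2 * m + 6 + ε)) + 2) ∨
    (3 * m + 6 + ε ≤ v ∧ v < 3 * m + 8 + ε ∧ doubleLo m ε v = 2 * (v - (2 * m + 6 + ε)) + 1 ∧
      doubleHi m ε v = 2 * (v - (2 * m + 6 + ε)) + 3) ∨
    (v = 3 * m + 8 + ε ∧ doubleLo m ε v = 0 ∧ doubleHi m ε v = 2 * m) ∨
    (v = 3 * m + 9 + ε ∧ doubleLo m ε v = 2 * m + 1 ∧ doubleHi m ε v = 2 * m + 5) ∨
    (3 * m + 10 + ε ≤ v ∧ doubleLo m ε v = 0 ∧ doubleHi m ε v = 2 * m + 6 + ε) := by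
  unfold doubleLo doubleHi
  split_ifs <;> omega

lemma isHalinData_doubleSpider {m ε : ℕ} (hm : 2 ≤ m) (hε : ε ≤ 1) :
    IsHalinData (3 * m + 11 + ε) (2 * m + 6 + ε) (doubleParent m ε) (doubleLo m ε)
      (doubleHi m ε) where
  five_le := by omega
  lt_card := by omega
  lt_par v hv := by have := doubleParent_spec m ε v; omega
  par_lt v hv := by have := doubleParent_spec m ε v; omega
  le_par v hv := by have := doubleParent_spec m ε v; omega
  children v hv hv' := by
    by_cases h : v < 3 * m + 6 + ε
    · exact ⟨2 * (v - (2 * m + 6 + ε)), 2 * (v - (2 * m + 6 + ε)) + 1, by grind [doubleParent]⟩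
    by_cases h : v < 3 * m + 8 + ε
    · exact ⟨2 * (v - (2 * m + 6 + ε)) + 1, 2 * (v - (2 * m + 6 + ε)) + 2,
        by grind [doubleParent]⟩
    by_cases h : v = 3 * m + 8 + ε
    · exact ⟨2 * m + 6 + ε, 2 * m + 7 + ε, by grind [doubleParent]⟩
    by_cases h : v = 3 * m + 9 + ε
    · exact ⟨3 * m + 6 + ε, 3 * m + 7 + ε, by grind [doubleParent]⟩
    · exact ⟨3 * m + 8 + ε, 3 * m + 9 + ε, by grind [doubleParent]⟩
  root_children := ⟨2 * m, 2 * m + 5, 3 * m + 9 + ε, by grind [doubleParent]⟩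
  lo_leaf x hx := if_pos hx
  hi_leaf x hx := if_pos hx
  nested v hv := by
    have h2 := doubleLo_doubleHi_spec m ε v
    have h3 := doubleLo_doubleHi_spec m ε (doubleParent m ε v)
    rcases doubleParent_spec m ε v with h | h | h | h | h | h | h <;> omega
  lo_lt_hi v hv := by have := doubleLo_doubleHi_spec m ε v; omega
  hi_le v hv := by have := doubleLo_doubleHi_spec m ε v; omega
  proper v hv := by have := doubleLo_doubleHi_spec m ε v; omega
  laminar y v hyv hv h1 h2 := by
    have h4 := doubleLo_doubleHi_spec m ε v
    have h5 := doubleLo_doubleHi_spec m ε y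
    have h6 := doubleLo_doubleHi_spec m ε (doubleParent m ε y)
    rcases doubleParent_spec m ε y with h | h | h | h | h | h | h <;>
      rcases h5 with h5 | h5 | h5 | h5 | h5 | h5 <;> omega
  par_par_ne x hx h := by
    have h1 := doubleParent_spec m ε x
    have h2 := doubleParent_spec m ε (doubleParent m ε x)
    have h3 := doubleParent_spec m ε (cyclicSucc (2 * m + 6 + ε) x)
    have h4 : cyclicSucc (2 * m + 6 + ε) x =
      if x + 1 = 2 * m + 6 + ε then 0 else x + 1 := rfl
    split_ifs at h4 <;> omega
  par_ne_par_par x hx h := by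
    have h1 := doubleParent_spec m ε x
    have h2 := doubleParent_spec m ε (cyclicSucc (2 * m + 6 + ε) x)
    have h3 := doubleParent_spec m ε (doubleParent m ε (cyclicSucc (2 * m + 6 + ε) x))
    have h4 : cyclicSucc (2 * m + 6 + ε) x =
      if x + 1 = 2 * m + 6 + ε then 0 else x + 1 := rfl
    split_ifs at h4 <;> omega
  par_ne_par x hx := by
    have h1 := doubleParent_spec m ε x
    have h2 := doubleParent_spec m ε
      (cyclicSucc (2 * m + 6 + ε) (cyclicSucc (2 * m + 6 + ε) x))
    unfold cyclicSucc at *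
    split_ifs at * <;> omega

end HalinTuran

/-- For every integer `n ≥ 16`, the maximum number of edges of an `n`-vertex `C₄`-free
Halin graph equals `5(n-1)/3` if `n ≡ 1 (mod 3)`, `5(n-2)/3 + 1` if `n ≡ 2 (mod 3)`,
and `5(n-3)/3 + 3` if `n ≡ 0 (mod 3)`: this value is attained and never exceeded. -/
theorem halin_turan_C4 (n : ℕ) (hn : 16 ≤ n) :
    IsGreatest {m : ℕ | ∃ H : HalinGraph (Fin n), C4Free H.graph ∧ m = eCount H.graph}
      (if n % 3 = 1 then 5 * (n - 1) / 3
      else if n % 3 = 2 then 5 * (n - 2) / 3 + 1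
      else 5 * (n - 3) / 3 + 3) := by
  classical
  constructor
  · have key : ∃ L par lo hi, HalinTuran.IsHalinData n L par lo hi ∧
        L = 2 * (n - 1) / 3 := by
      obtain h | h | h : n % 3 = 1 ∨ n % 3 = 2 ∨ n % 3 = 0 := by omega
      · obtain ⟨k, rfl⟩ : ∃ k, n = 3 * k + 1 := ⟨n / 3, by omega⟩
        exact ⟨_, _, _, _, HalinTuran.isHalinData_spider (by omega), by omega⟩
      · obtain ⟨m, rfl⟩ : ∃ m, n = 3 * m + 11 + 0 := ⟨(n - 11) / 3, by omega⟩
        exact ⟨_, _, _, _, HalinTuran.isHalinData_doubleSpider (by omega) (by omega), by omega⟩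
      · obtain ⟨m, rfl⟩ : ∃ m, n = 3 * m + 11 + 1 := ⟨(n - 12) / 3, by omega⟩
        exact ⟨_, _, _, _, HalinTuran.isHalinData_doubleSpider (by omega) (by omega), by omega⟩
    obtain ⟨L, par, lo, hi, D, hL⟩ := key
    refine ⟨D.toHalinGraph, D.c4Free_graph, ?_⟩
    have := D.eCount_toHalinGraph
    split_ifs <;> omega
  · rintro m ⟨H, hH, rfl⟩
    have h1 := HalinTuran.eCount_graph H
    have h2 := HalinTuran.three_mul_card_leaves_le H hH
    rw [Fintype.card_fin] at h1 h2
    split_ifs <;> omega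
end

section
/- Let H be an n-vertex C4-free Halin graph with characteristic tree T. If T contains a semi-branching vertex of degree at least 4, then there exists an (n−1)-vertex C4-free Halin graph H′ such that e(H) = e(H′) + 2. -/
open SimpleGraph

namespace SimpleGraph

variable {V W : Type*}

lemma Reachable.closed {G : SimpleGraph V} {P : V → Prop} {y z : V} (h : G.Reachable y z)
    (hP : ∀ u w, G.Adj u w → P u → P w) (hy : P y) : P z := by
  obtain ⟨w⟩ := h
  induction w with
  | nil => exact hy
  | cons hadj _ ih => exact ih (hP _ _ hadj hy)

lemma Reachable.map_of_adj_reachable {G : SimpleGraph V} {G' : SimpleGraph W} {y z : V}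
    (h : G.Reachable y z) (φ : V → W)
    (hφ : ∀ u w, G.Adj u w → G'.Reachable (φ u) (φ w)) : G'.Reachable (φ y) (φ z) :=
  h.closed (P := fun t ↦ G'.Reachable (φ y) (φ t)) (fun u w huw hu ↦ hu.trans (hφ u w huw)) .rfl

lemma Connected.induce_closed {G : SimpleGraph V} {S : Set V} (h : (G.induce S).Connected)
    {P : V → Prop} {y z : V} (hy : y ∈ S) (hz : z ∈ S)
    (hP : ∀ u ∈ S, ∀ w ∈ S, G.Adj u w → P u → P w) (hPy : P y) : P z :=
  (h.preconnected ⟨y, hy⟩ ⟨z, hz⟩).closed (P := fun t ↦ P t.1)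
    (fun u w huw hu ↦ hP u u.2 w w.2 huw hu) hPy

/-- If every neighbour of `x` is `a` or `b`, then deleting `x` and joining `a` to `b` keeps
connected vertex sets connected. -/
lemma Connected.induce_preimage_of_bypass {G : SimpleGraph V} {G' : SimpleGraph W} {f : W → V}
    {S : Set V} (h : (G.induce S).Connected) {x a b : V} (hf : ∀ y, y ≠ x → ∃ w, f w = y)
    (hx : ∀ z, G.Adj x z → z = a ∨ z = b)
    (hax : a ≠ x) (hbx : b ≠ x) (hfx : ∀ w, f w ≠ x)
    (hinj : Function.Injective f)
    (hG : ∀ y z, G.Adj (f y) (f z) → G'.Adj y z)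
    (hab : ∀ y z, f y = a → f z = b → G'.Adj y z)
    (hne : ∃ y ∈ S, y ≠ x) : (G'.induce (f ⁻¹' S)).Connected := by
  classical
  have : Nonempty W := ⟨(hf a hax).choose⟩
  choose! g hg using hf
  have hgf : ∀ w, g (f w) = w := fun w ↦ hinj (hg _ (hfx w))
  obtain ⟨y₀, hy₀, hy₀x⟩ := hne
  let t : V := if a ∈ S then a else if b ∈ S then b else y₀
  have htS : t ∈ S := by grind
  have htx : t ≠ x := by grind
  let φ : S → f ⁻¹' S := fun s ↦
    if hs : s.1 = x then ⟨g t, by simpa [hg t htx] using htS⟩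
    else ⟨g s.1, by simp [hg s.1 hs]⟩
  have hφx : ∀ s : S, s.1 = x → (φ s).1 = g t := by grind
  have hφ : ∀ s : S, s.1 ≠ x → (φ s).1 = g s.1 := by grind
  have hreach : ∀ u w : f ⁻¹' S, (u.1 = w.1 ∨ G'.Adj u.1 w.1) →
      (G'.induce (f ⁻¹' S)).Reachable u w := by
    rintro u w (huw | huw)
    · rw [Subtype.ext huw]
    · exact Adj.reachable huw
  have hkey : ∀ z : S, G.Adj x z.1 → g t = g z.1 ∨ G'.Adj (g t) (g z.1) := by
    intro z hz
    have := z.2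
    by_cases ha : a ∈ S
    · have hta : t = a := by grind
      rcases hx _ hz with h1 | h1
      · left; rw [hta, h1]
      · right; exact hab _ _ (by rw [hta, hg a hax]) (by rw [h1, hg b hbx])
    · left
      have : z.1 = b := by grind
      grind
  have hstep : ∀ u w : S, (G.induce S).Adj u w →
      (G'.induce (f ⁻¹' S)).Reachable (φ u) (φ w) := by
    intro u w huw
    have huw : G.Adj u.1 w.1 := huw
    by_cases hu : u.1 = x
    · have hw : w.1 ≠ x := fun h ↦ huw.ne (hu.trans h.symm)
      apply hreach
      rw [hφx u hu, hφ w hw]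
      exact hkey w (hu ▸ huw)
    · by_cases hw : w.1 = x
      · apply Reachable.symm
        apply hreach
        rw [hφx w hw, hφ u hu]
        exact hkey u (hw ▸ huw.symm)
      · apply hreach
        right
        rw [hφ u hu, hφ w hw]
        apply hG
        rwa [hg _ hu, hg _ hw]
  have hφf : ∀ w : f ⁻¹' S, φ ⟨f w.1, w.2⟩ = w := fun w ↦
    Subtype.ext ((hφ ⟨f w.1, w.2⟩ (hfx w.1)).trans (hgf w.1))
  have : Nonempty (f ⁻¹' S) := ⟨φ ⟨y₀, hy₀⟩⟩
  refine ⟨fun u w ↦ ?_⟩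
  rw [← hφf u, ← hφf w]
  exact (h.preconnected ⟨f u.1, u.2⟩ ⟨f w.1, w.2⟩).map_of_adj_reachable φ hstep

/-- The vertices on the side of `u` after deleting the edge `uw`. -/
def sideOf (T : SimpleGraph V) (u w : V) : Set V :=
  {y | (T.deleteEdges {s(u, w)}).Reachable u y}

lemma self_mem_sideOf (T : SimpleGraph V) (u w : V) : u ∈ T.sideOf u w :=
  Reachable.refl _

variable {T : SimpleGraph V}

lemma IsAcyclic.notMem_sideOf (hT : T.IsAcyclic) {u w : V} (h : T.Adj u w) :
    w ∉ T.sideOf u w :=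
  isAcyclic_iff_forall_adj_isBridge.mp hT h

lemma IsAcyclic.mem_sideOf_of_adj (hT : T.IsAcyclic) {u w y z : V} (h : T.Adj u w)
    (hy : y ∈ T.sideOf u w) (hyz : T.Adj y z) (hz : z ≠ w) : z ∈ T.sideOf u w := by
  have hyw : y ≠ w := fun e ↦ hT.notMem_sideOf h (e ▸ hy)
  refine Reachable.trans hy (Adj.reachable ?_)
  simp only [deleteEdges_adj, Set.mem_singleton_iff, Sym2.eq_iff]
  grind

lemma IsAcyclic.sideOf_disjoint (hT : T.IsAcyclic) {v p q y : V} (hp : T.Adj p v)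
    (hq : T.Adj q v) (hpq : p ≠ q) (hyp : y ∈ T.sideOf p v) (hyq : y ∈ T.sideOf q v) : False := by
  have hyq' : (T.deleteEdges {s(q, v)}).Reachable y q := Reachable.symm hyq
  have h := hyq'.closed (P := fun z ↦ z ∈ T.sideOf p v ∧ z ∈ T.sideOf q v) (by
    intro a b hab ⟨hap, haq⟩
    have hb : b ∈ T.sideOf q v := Reachable.trans haq hab.reachable
    have hbv : b ≠ v := fun e ↦ hT.notMem_sideOf hq (e ▸ hb)
    exact ⟨hT.mem_sideOf_of_adj hp hap (deleteEdges_le _ hab) hbv, hb⟩) ⟨hyp, hyq⟩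
  refine hT.notMem_sideOf hp (Reachable.trans h.1 (Adj.reachable ?_))
  simp only [deleteEdges_adj, Set.mem_singleton_iff, Sym2.eq_iff]
  have := hp.ne
  grind

lemma IsTree.exists_mem_sideOf (hT : T.IsTree) {v y : V} (hy : y ≠ v) :
    ∃ p, T.Adj p v ∧ y ∈ T.sideOf p v := by
  have h := (hT.connected.preconnected v y).closed
    (P := fun z ↦ z ≠ v → ∃ p, T.Adj p v ∧ z ∈ T.sideOf p v) (by
    intro a b hab ha hb
    by_cases hav : a = v
    · exact ⟨b, hav ▸ hab.symm, self_mem_sideOf _ _ _⟩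
    · obtain ⟨p, hp, hap⟩ := ha hav
      exact ⟨p, hp, hT.isAcyclic.mem_sideOf_of_adj hp hap hab hb⟩) (fun h ↦ (h rfl).elim)
  exact h hy

lemma IsTree.mem_sideOf_symm_iff (hT : T.IsTree) {v q y : V} (hq : T.Adj q v) :
    y ∈ T.sideOf v q ↔ y ∉ T.sideOf q v := by
  constructor
  · intro h h'
    have h : (T.deleteEdges {s(q, v)}).Reachable v y := by rw [Sym2.eq_swap]; exact h
    exact hT.isAcyclic.notMem_sideOf hq (Reachable.trans h' h.symm)
  · intro h
    have := (hT.connected.preconnected v y).closed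
      (P := fun z ↦ z ∈ T.sideOf v q ∨ z ∈ T.sideOf q v) (by
      rintro a b hab (ha | ha)
      · by_cases hb : b = q
        · exact .inr (hb ▸ self_mem_sideOf _ _ _)
        · exact .inl (hT.isAcyclic.mem_sideOf_of_adj hq.symm ha hab hb)
      · by_cases hb : b = v
        · exact .inl (hb ▸ self_mem_sideOf _ _ _)
        · exact .inr (hT.isAcyclic.mem_sideOf_of_adj hq ha hab hb)) (.inl (self_mem_sideOf _ _ _))
    tauto

lemma IsAcyclic.sideOf_subset (hT : T.IsAcyclic) {u w z : V} (huw : T.Adj u w)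
    (hz : T.Adj z u) (hzw : z ≠ w) : T.sideOf z u ⊆ T.sideOf u w := by
  intro y hy
  have h := Reachable.closed (P := fun t ↦ t ∈ T.sideOf z u ∧ t ∈ T.sideOf u w) hy (by
    intro a b hab ⟨ha, ha'⟩
    have hb : b ∈ T.sideOf z u := Reachable.trans ha hab.reachable
    refine ⟨hb, hT.mem_sideOf_of_adj huw ha' (deleteEdges_le _ hab) ?_⟩
    rintro rfl
    exact hT.sideOf_disjoint hz huw.symm hzw hb (self_mem_sideOf _ _ _))
    ⟨self_mem_sideOf _ _ _, hT.mem_sideOf_of_adj huw (self_mem_sideOf _ _ _) hz.symm hzw⟩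
  exact h.2

end SimpleGraph

section Degree

variable {V : Type*} {G : SimpleGraph V}

lemma exists_adj_of_ncDeg_pos {y : V} (h : 0 < ncDeg G y) : ∃ z, G.Adj y z :=
  Set.nonempty_of_ncard_ne_zero h.ne'

lemma eq_of_ncDeg_eq_one {y p z : V} (h : ncDeg G y = 1) (hp : G.Adj y p) (hz : G.Adj y z) :
    z = p := by
  obtain ⟨a, ha⟩ := Set.ncard_eq_one.mp h
  have h1 : p ∈ G.neighborSet y := hp
  have h2 : z ∈ G.neighborSet y := hz
  grind

lemma eq_or_eq_of_ncDeg_eq_two {y p q z : V} (h : ncDeg G y = 2) (hp : G.Adj y p)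
    (hq : G.Adj y q) (hpq : p ≠ q) (hz : G.Adj y z) : z = p ∨ z = q := by
  obtain ⟨a, b, -, hab⟩ := Set.ncard_eq_two.mp h
  have h1 : p ∈ G.neighborSet y := hp
  have h2 : q ∈ G.neighborSet y := hq
  have h3 : z ∈ G.neighborSet y := hz
  grind

lemma exists_adj_notMem_of_card_lt_ncDeg {y : V} (s : Finset V) (h : s.card < ncDeg G y) :
    ∃ z, G.Adj y z ∧ z ∉ s := by
  obtain ⟨z, hz, hzs⟩ := Set.exists_mem_notMem_of_ncard_lt_ncard
    (s := (s : Set V)) (t := G.neighborSet y) (by rw [Set.ncard_coe_finset]; exact h)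
  exact ⟨z, hz, by simpa using hzs⟩

lemma c4Free_iff : C4Free G ↔ ∀ p q r s : V, G.Adj p q → G.Adj q r → G.Adj r s → G.Adj s p →
    p ≠ r → q ≠ s → False := by
  constructor
  · intro h p q r s hpq hqr hrs hsp hpr hqs
    refine h p (.cons hpq (.cons hqr (.cons hrs (.cons hsp .nil)))) ?_ rfl
    have := hpq.ne
    have := hqr.ne
    have := hrs.ne
    have := hsp.ne
    simp only [Walk.cons_isCycle_iff, Walk.cons_isPath_iff, Walk.isPath_iff_nil]
    simp
    grind
  · intro h v w hw hlen
    match w, hw, hlen with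
    | .cons hpq (.cons hqr (.cons hrs (.cons hsp .nil))), hw, _ =>
      have hn := hw.support_nodup
      simp at hn
      exact h _ _ _ _ hpq hqr hrs hsp (by grind) (by grind)

end Degree

namespace HalinGraph

variable {V : Type*} [Fintype V] (H : HalinGraph V)

lemma ncDeg_C {y : V} (hy : IsLeaf H.T y) : ncDeg H.C y = 2 :=
  H.two_regular y (by rw [H.support_C]; exact hy)

variable {H}

lemma isLeaf_of_C_adj {y z : V} (h : H.C.Adj y z) : IsLeaf H.T y := by
  have : y ∈ H.C.support := ⟨z, h⟩
  rwa [H.support_C] at this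

lemma exists_isLeaf_mem_sideOf {u w : V} (h : H.T.Adj u w) :
    ∃ y, IsLeaf H.T y ∧ y ∈ H.T.sideOf u w := by
  obtain ⟨y⟩ := (H.planar u w h).nonempty
  exact ⟨y.1, y.2⟩

lemma exists_two_isLeaf_mem_sideOf {u w : V} (h : H.T.Adj u w) (hu : ¬ IsLeaf H.T u) :
    ∃ y z, y ≠ z ∧ IsLeaf H.T y ∧ IsLeaf H.T z ∧ y ∈ H.T.sideOf u w ∧ z ∈ H.T.sideOf u w := by
  classical
  have hT := H.tree_isTree.isAcyclic
  have hd := H.nonleaf_degree u hu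
  obtain ⟨p, hp, hpw⟩ := exists_adj_notMem_of_card_lt_ncDeg {w}
    (show Finset.card {w} < ncDeg H.T u by simp; omega)
  obtain ⟨q, hq, hqw⟩ := exists_adj_notMem_of_card_lt_ncDeg {w, p}
    (show Finset.card {w, p} < ncDeg H.T u from Finset.card_le_two.trans_lt (by omega))
  simp only [Finset.mem_singleton, Finset.mem_insert, not_or] at hpw hqw
  obtain ⟨y, hy, hyp⟩ := exists_isLeaf_mem_sideOf hp.symm
  obtain ⟨z, hz, hzq⟩ := exists_isLeaf_mem_sideOf hq.symm
  refine ⟨y, z, ?_, hy, hz, hT.sideOf_subset h hp.symm hpw hyp,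
    hT.sideOf_subset h hq.symm hqw.1 hzq⟩
  rintro rfl
  exact hT.sideOf_disjoint hp.symm hq.symm (Ne.symm hqw.2) hyp hzq

lemma not_T_adj_of_isLeaf {v y z : V} (hv : ¬ IsLeaf H.T v) (hy : IsLeaf H.T y)
    (hz : IsLeaf H.T z) : ¬ H.T.Adj y z := by
  intro h
  have := (H.tree_isTree.connected.preconnected y v).closed (P := fun t ↦ t = y ∨ t = z) (by
    rintro a b hab (rfl | rfl)
    · exact .inr (eq_of_ncDeg_eq_one hy h hab)
    · exact .inl (eq_of_ncDeg_eq_one hz h.symm hab)) (.inl rfl)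
  grind

lemma sideOf_isLeaf {u w y : V} (h : H.T.Adj u w) (hu : IsLeaf H.T u)
    (hy : y ∈ H.T.sideOf u w) : y = u :=
  Reachable.closed (P := fun t ↦ t = u) hy (by
    rintro a b hab rfl
    have hb : b = w := eq_of_ncDeg_eq_one hu h (deleteEdges_le _ hab)
    subst hb
    simp at hab) rfl

/-- Each branch at a semi-branching vertex of degree at least four leaves out three leaves
besides any given leaf neighbour not on that branch. -/
lemma exists_three_isLeaf {v x q : V} (hsb : SemiBranching H.T v) (hdeg : 4 ≤ ncDeg H.T v)
    (hvx : H.T.Adj v x) (hx : IsLeaf H.T x) (hq : H.T.Adj q v) (hqx : q ≠ x) :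
    ∃ y₁ y₂ y₃, [x, y₁, y₂, y₃].Nodup ∧
      ∀ y ∈ [y₁, y₂, y₃], IsLeaf H.T y ∧ y ∉ H.T.sideOf q v := by
  classical
  have hT := H.tree_isTree.isAcyclic
  obtain ⟨r, hr, hrq, hrl⟩ : ∃ r, H.T.Adj v r ∧ r ≠ q ∧ ¬ IsLeaf H.T r := by
    obtain ⟨-, -, r, r', hne, hr, hr', hl, hl'⟩ := hsb
    by_cases h : r = q
    · exact ⟨r', hr', by grind, hl'⟩
    · exact ⟨r, hr, h, hl⟩
  obtain ⟨s, hs, hsn⟩ := exists_adj_notMem_of_card_lt_ncDeg {x, q, r}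
    (show Finset.card {x, q, r} < ncDeg H.T v from Finset.card_le_three.trans_lt (by omega))
  simp only [Finset.mem_singleton, Finset.mem_insert, not_or] at hsn
  have hrx : r ≠ x := by rintro rfl; exact hrl hx
  obtain ⟨y₁, y₂, hne, hl₁, hl₂, h₁, h₂⟩ := exists_two_isLeaf_mem_sideOf hr.symm hrl
  obtain ⟨y₃, hl₃, h₃⟩ := exists_isLeaf_mem_sideOf hs.symm
  have hxx := self_mem_sideOf H.T x v
  have key : ∀ {a b y z : V}, H.T.Adj v a → H.T.Adj v b → a ≠ b → y ∈ H.T.sideOf a v →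
      z ∈ H.T.sideOf b v → y ≠ z := by
    rintro a b y z ha hb hab hy hz rfl
    exact hT.sideOf_disjoint ha.symm hb.symm hab hy hz
  refine ⟨y₁, y₂, y₃, ?_, ?_⟩
  · have := key hvx hr hrx.symm hxx h₁
    have := key hvx hr hrx.symm hxx h₂
    have := key hvx hs (Ne.symm hsn.1) hxx h₃
    have := key hr hs (Ne.symm hsn.2.2) h₁ h₃
    have := key hr hs (Ne.symm hsn.2.2) h₂ h₃
    simp
    grind
  · simp only [List.mem_cons, List.not_mem_nil, or_false]
    rintro y (rfl | rfl | rfl)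
    · exact ⟨hl₁, fun h ↦ key hr hq.symm hrq h₁ h rfl⟩
    · exact ⟨hl₂, fun h ↦ key hr hq.symm hrq h₂ h rfl⟩
    · exact ⟨hl₃, fun h ↦ key hs hq.symm hsn.2.1 h₃ h rfl⟩

/-- A proper branch `q` at `v` is not complemented, among the leaves, by three leaves
including `x`. -/
lemma not_forall_leaf_mem {v x q a d : V} (hsb : SemiBranching H.T v) (hdeg : 4 ≤ ncDeg H.T v)
    (hvx : H.T.Adj v x) (hx : IsLeaf H.T x) (hq : H.T.Adj q v) (hqx : q ≠ x)
    (h : ∀ y, IsLeaf H.T y → y ∉ H.T.sideOf q v → y = x ∨ y = a ∨ y = d) : False := by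
  obtain ⟨y₁, y₂, y₃, hn, hy⟩ := exists_three_isLeaf hsb hdeg hvx hx hq hqx
  have h1 := hy y₁ (by simp)
  have h2 := hy y₂ (by simp)
  have h3 := hy y₃ (by simp)
  have := h _ h1.1 h1.2
  have := h _ h2.1 h2.2
  have := h _ h3.1 h3.2
  simp at hn
  grind

/-- The cycle neighbours of a leaf neighbour of a semi-branching vertex of degree at least four
are not adjacent on the cycle. -/
lemma not_C_adj_bypass {v x a b : V} (hsb : SemiBranching H.T v) (hdeg : 4 ≤ ncDeg H.T v)
    (hvx : H.T.Adj v x) (hx : IsLeaf H.T x) (ha : H.C.Adj x a) (hb : H.C.Adj x b) (hab : a ≠ b) :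
    ¬ H.C.Adj a b := by
  intro h
  obtain ⟨q, hq, hqx⟩ := exists_adj_notMem_of_card_lt_ncDeg {x}
    (show Finset.card {x} < ncDeg H.T v by simp; omega)
  refine not_forall_leaf_mem (a := a) (d := b) hsb hdeg hvx hx hq.symm (by simpa using hqx) ?_
  intro y hy _
  refine H.cycle_connected.induce_closed (P := fun t ↦ t = x ∨ t = a ∨ t = b) (y := x)
    (by rw [H.support_C]; exact hx) (by rw [H.support_C]; exact hy) ?_ (.inl rfl)
  rintro s - t - hst (rfl | rfl | rfl)
  · exact .inr (eq_or_eq_of_ncDeg_eq_two (H.ncDeg_C hx) ha hb hab hst)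
  · have := eq_or_eq_of_ncDeg_eq_two (H.ncDeg_C (isLeaf_of_C_adj h)) ha.symm h hb.ne hst
    tauto
  · have := eq_or_eq_of_ncDeg_eq_two (H.ncDeg_C (isLeaf_of_C_adj h.symm)) hb.symm h.symm ha.ne hst
    tauto

lemma no_bypass_path_of_not_adj {v x a b c d : V} (hfree : C4Free H.graph)
    (hsb : SemiBranching H.T v) (hdeg : 4 ≤ ncDeg H.T v) (hvx : H.T.Adj v x) (hx : IsLeaf H.T x)
    (ha : H.C.Adj x a) (hb : H.C.Adj x b) (hab : a ≠ b) (hvb : ¬ H.T.Adj v b)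
    (had : H.graph.Adj a d) (hdc : H.graph.Adj d c) (hcb : H.graph.Adj c b)
    (hca : c ≠ a) (hdb : d ≠ b) (hcx : c ≠ x) (hdx : d ≠ x) : False := by
  have hT := H.tree_isTree
  have hal := isLeaf_of_C_adj ha.symm
  have hbl := isLeaf_of_C_adj hb.symm
  have hv := hsb.1
  obtain ⟨q, hq, hbq⟩ := hT.exists_mem_sideOf (v := v) (y := b) (by rintro rfl; exact hv hbl)
  have hqb : q ≠ b := by rintro rfl; exact hvb hq.symm
  have hql : ¬ IsLeaf H.T q := fun h ↦ hqb (sideOf_isLeaf hq h hbq).symm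
  have hqx : q ≠ x := by rintro rfl; exact hql hx
  have hxq : x ∉ H.T.sideOf q v := fun h ↦
    hT.isAcyclic.sideOf_disjoint hq hvx.symm hqx h (self_mem_sideOf _ _ _)
  have hvq : v ∉ H.T.sideOf q v := hT.isAcyclic.notMem_sideOf hq
  obtain ⟨b', hbb', hb'q⟩ : ∃ b', H.C.Adj b b' ∧ b' ∈ H.T.sideOf q v := by
    by_contra! hcon
    obtain ⟨y, z, hyz, hyl, hzl, hyq, hzq⟩ := exists_two_isLeaf_mem_sideOf hq hql
    have key : ∀ y, IsLeaf H.T y → y ∈ H.T.sideOf q v → y = b := fun y hyl hyq ↦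
      (H.planar q v hq).induce_closed (P := fun t ↦ t = b) (y := b) ⟨hbl, hbq⟩ ⟨hyl, hyq⟩
        (by rintro s - t ht hst rfl; exact (hcon t hst ht.2).elim) rfl
    exact hyz ((key y hyl hyq).trans (key z hzl hzq).symm)
  have hcq : c ∈ H.T.sideOf q v := by
    rcases hcb with hcb | hcb
    · exact hT.isAcyclic.mem_sideOf_of_adj hq hbq hcb.symm (by rintro rfl; exact hvb hcb)
    · rcases eq_or_eq_of_ncDeg_eq_two (H.ncDeg_C hbl) hb.symm hbb'
        (by rintro rfl; exact hxq hb'q) hcb.symm with h | h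
      · exact (hcx h).elim
      · exact h ▸ hb'q
  have hTG : H.T ≤ H.graph := le_sup_left
  have hCG : H.C ≤ H.graph := le_sup_right
  have hcross : ∀ y z, H.graph.Adj y z → y ∈ H.T.sideOf q v → z ∉ H.T.sideOf q v → z ≠ v →
      H.C.Adj y z := by
    rintro y z (h | h) hy hz hzv
    · exact (hz (hT.isAcyclic.mem_sideOf_of_adj hq hy h hzv)).elim
    · exact h
  have hav : a ≠ v := by rintro rfl; exact hv hal
  have hpl := H.planar v q hq.symm
  have hout : ∀ P : V → Prop, P x →
      (∀ s t, s ∉ H.T.sideOf q v → t ∉ H.T.sideOf q v → H.C.Adj s t → P s → P t) →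
      ∀ y, IsLeaf H.T y → y ∉ H.T.sideOf q v → P y := by
    intro P hPx hP y hyl hyq
    refine hpl.induce_closed (y := x) ⟨hx, (hT.mem_sideOf_symm_iff hq).mpr hxq⟩
      ⟨hyl, (hT.mem_sideOf_symm_iff hq).mpr hyq⟩ ?_ hPx
    intro s hs t ht
    exact hP s t ((hT.mem_sideOf_symm_iff hq).mp hs.2) ((hT.mem_sideOf_symm_iff hq).mp ht.2)
  refine not_forall_leaf_mem (a := a) (d := d) hsb hdeg hvx hx hq hqx ?_
  by_cases hdv : d = v
  · subst hdv
    have hqc : q = c := by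
      rcases hdc with h | h
      · by_contra hne
        exact hT.isAcyclic.sideOf_disjoint hq h.symm hne hcq (self_mem_sideOf _ _ _)
      · exact (hv (isLeaf_of_C_adj h)).elim
    subst hqc
    exact (c4Free_iff.mp hfree d x b q (hTG hvx) (hCG hb) hcb.symm (hTG hq) hdb
      (Ne.symm hqx)).elim
  · have haC : a ∉ H.T.sideOf q v → H.C.Adj a d := by
      intro haq
      by_cases hdq : d ∈ H.T.sideOf q v
      · exact (hcross d a had.symm hdq haq hav).symm
      · have hdl := isLeaf_of_C_adj (hcross c d hdc.symm hcq hdq hdv).symm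
        exact had.resolve_left (not_T_adj_of_isLeaf hv hal hdl)
    refine hout _ (.inl rfl) ?_
    rintro s t hs ht hst (rfl | rfl | rfl)
    · rcases eq_or_eq_of_ncDeg_eq_two (H.ncDeg_C hx) ha hb hab hst with h | h
      · exact .inr (.inl h)
      · exact (ht (h ▸ hbq)).elim
    · have := eq_or_eq_of_ncDeg_eq_two (H.ncDeg_C hal) ha.symm (haC hs) (Ne.symm hdx) hst
      tauto
    · have hdC := (hcross c s hdc.symm hcq hs hdv).symm
      have hda : H.C.Adj s a := had.symm.resolve_left
        (not_T_adj_of_isLeaf hv (isLeaf_of_C_adj hdC) hal)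
      rcases eq_or_eq_of_ncDeg_eq_two (H.ncDeg_C (isLeaf_of_C_adj hdC)) hda hdC
        (Ne.symm hca) hst with h | h
      · exact .inr (.inl h)
      · exact (ht (h ▸ hcq)).elim

lemma no_bypass_path {v x a b c d : V} (hfree : C4Free H.graph)
    (hsb : SemiBranching H.T v) (hdeg : 4 ≤ ncDeg H.T v) (hvx : H.T.Adj v x) (hx : IsLeaf H.T x)
    (ha : H.C.Adj x a) (hb : H.C.Adj x b) (hab : a ≠ b)
    (had : H.graph.Adj a d) (hdc : H.graph.Adj d c) (hcb : H.graph.Adj c b)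
    (hca : c ≠ a) (hdb : d ≠ b) (hcx : c ≠ x) (hdx : d ≠ x) : False := by
  by_cases hvb : H.T.Adj v b
  · by_cases hva : H.T.Adj v a
    · exact c4Free_iff.mp hfree v a x b (.inl hva) (.inr ha.symm) (.inr hb) (.inl hvb.symm)
        hvx.ne hab
    · exact no_bypass_path_of_not_adj hfree hsb hdeg hvx hx hb ha hab.symm hva hcb.symm hdc.symm
        had.symm hdb hca hdx hcx
  · exact no_bypass_path_of_not_adj hfree hsb hdeg hvx hx ha hb hab hvb had hdc hcb hca hdb hcx hdx

end HalinGraph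

section Comap

variable {V W : Type*} {T : SimpleGraph V} {f : W → V} {x v : V}

lemma ncDeg_eq_ncard_of_image {G' : SimpleGraph W} (hinj : Function.Injective f) {w : W}
    {S : Set V} (h : f '' G'.neighborSet w = S) : ncDeg G' w = S.ncard := by
  rw [← h, Set.ncard_image_of_injective _ hinj]
  rfl

lemma image_neighborSet_comap (hfx : ∀ w, f w ≠ x) (hf : ∀ y, y ≠ x → ∃ w, f w = y) (w : W) :
    f '' (T.comap f).neighborSet w = T.neighborSet (f w) \ {x} := by
  ext y
  constructor
  · rintro ⟨z, hz, rfl⟩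
    exact ⟨hz, hfx z⟩
  · rintro ⟨hy, hyx⟩
    obtain ⟨z, rfl⟩ := hf y hyx
    exact ⟨z, hy, rfl⟩

lemma ncDeg_comap_of_ne (hinj : Function.Injective f) (hfx : ∀ w, f w ≠ x)
    (hf : ∀ y, y ≠ x → ∃ w, f w = y) (hvx : T.Adj v x) (hx : IsLeaf T x) {w : W} (hw : f w ≠ v) :
    ncDeg (T.comap f) w = ncDeg T (f w) := by
  rw [ncDeg_eq_ncard_of_image hinj (image_neighborSet_comap hfx hf w), Set.sdiff_singleton_eq_self]
  · rfl
  · intro h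
    exact hw (eq_of_ncDeg_eq_one hx hvx.symm (Adj.symm h))

lemma ncDeg_comap_of_eq (hinj : Function.Injective f) (hfx : ∀ w, f w ≠ x)
    (hf : ∀ y, y ≠ x → ∃ w, f w = y) (hvx : T.Adj v x) {w : W} (hw : f w = v) :
    ncDeg (T.comap f) w = ncDeg T v - 1 := by
  rw [ncDeg_eq_ncard_of_image hinj (image_neighborSet_comap hfx hf w), hw,
    Set.ncard_sdiff_singleton_of_mem (by exact hvx)]
  rfl

/-- Walks between other vertices can avoid the leaf `x`. -/
lemma reachable_of_le_of_isLeaf {G : SimpleGraph V} {G' : SimpleGraph W} (hGT : G ≤ T)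
    (hG : ∀ y z, G.Adj (f y) (f z) → G'.Adj y z) (hinj : Function.Injective f)
    (hfx : ∀ w, f w ≠ x) (hf : ∀ y, y ≠ x → ∃ w, f w = y) (hvx : T.Adj v x) (hx : IsLeaf T x)
    {u w : W} (h : G.Reachable (f u) (f w)) : G'.Reachable u w := by
  classical
  have : Nonempty W := ⟨u⟩
  choose! g hg using hf
  have hgf : ∀ w, g (f w) = w := fun w ↦ hinj (hg _ (hfx w))
  have h := h.map_of_adj_reachable (G' := G') (fun t ↦ if t = x then g v else g t) (by
    intro a b hab
    by_cases ha : a = x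
    · subst ha
      obtain rfl := eq_of_ncDeg_eq_one hx hvx.symm (hGT hab)
      simp
    · by_cases hb : b = x
      · subst hb
        obtain rfl := eq_of_ncDeg_eq_one hx hvx.symm (hGT hab).symm
        simp
      · simp only [ha, hb, if_false]
        exact (hG _ _ (by rwa [hg _ ha, hg _ hb])).reachable)
  simpa only [hfx, if_false, hgf] using h

lemma sideOf_comap (hinj : Function.Injective f) (hfx : ∀ w, f w ≠ x)
    (hf : ∀ y, y ≠ x → ∃ w, f w = y) (hvx : T.Adj v x) (hx : IsLeaf T x) (u w : W) :
    (T.comap f).sideOf u w = f ⁻¹' T.sideOf (f u) (f w) := by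
  ext y
  constructor
  · intro h
    refine Reachable.map_of_adj_reachable h f fun a b hab ↦ Adj.reachable ?_
    simp only [deleteEdges_adj, comap_adj, Set.mem_singleton_iff, Sym2.eq_iff] at hab ⊢
    grind
  · refine fun h ↦ reachable_of_le_of_isLeaf (deleteEdges_le _) ?_ hinj hfx hf hvx hx h
    intro a b hab
    simp only [deleteEdges_adj, comap_adj, Set.mem_singleton_iff, Sym2.eq_iff] at hab ⊢
    grind

lemma isTree_comap_of_isLeaf (hT : T.IsTree) (hinj : Function.Injective f)
    (hfx : ∀ w, f w ≠ x) (hf : ∀ y, y ≠ x → ∃ w, f w = y) (hvx : T.Adj v x) (hx : IsLeaf T x) :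
    (T.comap f).IsTree := by
  have : Nonempty W := ⟨(hf v hvx.ne).choose⟩
  refine ⟨⟨fun u w ↦ ?_⟩, hT.isAcyclic.of_comap ⟨f, hinj⟩⟩
  exact reachable_of_le_of_isLeaf (f := f) le_rfl (fun _ _ h ↦ h) hinj hfx hf hvx hx
    (hT.connected.preconnected (f u) (f w))

/-- Replacing the three edges at `x` by the edge `ab` loses two edges. -/
lemma eCount_of_bypass [Finite V] {G : SimpleGraph V} {G' : SimpleGraph W} {a b : V}
    (hxv : G.Adj x v) (hxa : G.Adj x a) (hxb : G.Adj x b)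
    (hva : v ≠ a) (hvb : v ≠ b) (hab : a ≠ b) (hG : ∀ z, G.Adj x z → z = v ∨ z = a ∨ z = b)
    (hnab : ¬ G.Adj a b) (hfx : ∀ w, f w ≠ x)
    (hf : ∀ y, y ≠ x → ∃ w, f w = y) (hinj : Function.Injective f)
    (hG' : ∀ y z, G'.Adj y z ↔ G.Adj (f y) (f z) ∨ f y = a ∧ f z = b ∨ f y = b ∧ f z = a) :
    eCount G = eCount G' + 2 := by
  have himg : Sym2.map f '' G'.edgeSet =
      insert s(a, b) (G.edgeSet \ {s(x, v), s(x, a), s(x, b)}) := by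
    ext e
    induction e with | h y z
    constructor
    · rintro ⟨e, he, hyz⟩
      induction e with | h s t
      rw [mem_edgeSet, hG'] at he
      have := hfx s
      have := hfx t
      simp only [Sym2.map_mk, Sym2.eq_iff, Set.mem_insert_iff, Set.mem_sdiff, mem_edgeSet,
        Set.mem_singleton_iff] at hyz ⊢
      have := G.adj_comm y z
      grind
    · intro h
      simp only [Sym2.eq_iff, Set.mem_insert_iff, Set.mem_sdiff, mem_edgeSet,
        Set.mem_singleton_iff] at h
      have := hxa.ne
      have := hxb.ne
      have := G.adj_comm y z
      have hy := hG y
      have hz := hG z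
      obtain ⟨s, rfl⟩ := hf y (by grind)
      obtain ⟨t, rfl⟩ := hf z (by grind)
      refine ⟨s(s, t), ?_, rfl⟩
      rw [mem_edgeSet, hG']
      grind
  have h1 : eCount G' = (insert s(a, b) (G.edgeSet \ {s(x, v), s(x, a), s(x, b)})).ncard := by
    rw [← himg, Set.ncard_image_of_injective _ (Sym2.map.injective hinj)]
    rfl
  have h2 : ({s(x, v), s(x, a), s(x, b)} : Set (Sym2 V)).ncard = 3 := by
    rw [Set.ncard_eq_three]
    refine ⟨_, _, _, ?_, ?_, ?_, rfl⟩ <;> simp <;> grind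
  have hsub : ({s(x, v), s(x, a), s(x, b)} : Set (Sym2 V)) ⊆ G.edgeSet := by
    rintro e (rfl | rfl | rfl) <;> assumption
  have h3 := Set.ncard_sdiff_add_ncard_of_subset hsub
  rw [Set.ncard_insert_of_notMem (by simp [hnab])] at h1
  have : eCount G = G.edgeSet.ncard := rfl
  omega

lemma c4Free_of_bypass {G : SimpleGraph V} {G' : SimpleGraph W} {a b : V}
    (hfree : C4Free G) (hfx : ∀ w, f w ≠ x) (hinj : Function.Injective f)
    (hpath : ∀ c d, G.Adj a d → G.Adj d c → G.Adj c b → c ≠ a → d ≠ b → c ≠ x → d ≠ x → False)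
    (hG' : ∀ y z, G'.Adj y z ↔ G.Adj (f y) (f z) ∨ f y = a ∧ f z = b ∨ f y = b ∧ f z = a) :
    C4Free G' := by
  rw [c4Free_iff] at hfree ⊢
  have key : ∀ p q r s, p ≠ r → q ≠ s → r ≠ x → s ≠ x → G.Adj q r → G.Adj r s → G.Adj s p →
      (p = a ∧ q = b ∨ p = b ∧ q = a) → False := by
    rintro p q r s hpr hqs hr hs hqr hrs hsp (⟨rfl, rfl⟩ | ⟨rfl, rfl⟩)
    · exact hpath r s hsp.symm hrs.symm hqr.symm hpr.symm hqs.symm hr hs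
    · exact hpath s r hqr hrs hsp hqs.symm hpr.symm hs hr
  intro p q r s hpq hqr hrs hsp hpr hqs
  have := hinj.ne hpq.ne
  have := hinj.ne hqr.ne
  rw [hG'] at hpq hqr hrs hsp
  have hpr : f p ≠ f r := hinj.ne hpr
  have hqs : f q ≠ f s := hinj.ne hqs
  have h := hfree (f p) (f q) (f r) (f s)
  have := hfx p
  have := hfx q
  have := hfx r
  have := hfx s
  have k1 := key (f p) (f q) (f r) (f s)
  have k2 := key (f q) (f r) (f s) (f p)
  have k3 := key (f r) (f s) (f p) (f q)
  have k4 := key (f s) (f p) (f q) (f r)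
  clear hpath hG' hfree key
  grind

end Comap

namespace HalinGraph

variable {V : Type*} [Fintype V] {H : HalinGraph V}

/-- Deleting the leaf `x` from a Halin graph and joining its two neighbours on the outer cycle. -/
lemma exists_bypass {W : Type*} [Fintype W] {f : W → V} {v x a b : V}
    (hsb : SemiBranching H.T v) (hdeg : 4 ≤ ncDeg H.T v) (hvx : H.T.Adj v x) (hx : IsLeaf H.T x)
    (ha : H.C.Adj x a) (hb : H.C.Adj x b) (hab : a ≠ b) (hfx : ∀ w, f w ≠ x)
    (hf : ∀ y, y ≠ x → ∃ w, f w = y) (hinj : Function.Injective f)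
    (hcard : Fintype.card W = Fintype.card V - 1) :
    ∃ H' : HalinGraph W, ∀ y z, H'.graph.Adj y z ↔
      H.graph.Adj (f y) (f z) ∨ f y = a ∧ f z = b ∨ f y = b ∧ f z = a := by
  have hv := hsb.1
  have hal := isLeaf_of_C_adj ha.symm
  have hbl := isLeaf_of_C_adj hb.symm
  have hnab := not_C_adj_bypass hsb hdeg hvx hx ha hb hab
  let C' : SimpleGraph W :=
    { Adj := fun y z ↦ H.C.Adj (f y) (f z) ∨ f y = a ∧ f z = b ∨ f y = b ∧ f z = a
      symm := ⟨fun y z h ↦ by have := H.C.adj_comm (f y) (f z); tauto⟩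
      loopless := ⟨fun y h ↦ by have := H.C.irrefl (v := f y); grind⟩ }
  have hleaf : ∀ w, IsLeaf (H.T.comap f) w ↔ IsLeaf H.T (f w) := by
    intro w
    unfold IsLeaf at *
    by_cases hw : f w = v
    · rw [ncDeg_comap_of_eq hinj hfx hf hvx hw, hw]
      omega
    · rw [ncDeg_comap_of_ne hinj hfx hf hvx hx hw]
  have hCx : ∀ z, H.C.Adj x z → z = a ∨ z = b := fun z hz ↦
    eq_or_eq_of_ncDeg_eq_two (H.ncDeg_C hx) ha hb hab hz
  have hbypass : ∀ w a b, H.C.Adj x a → H.C.Adj x b → a ≠ b → ¬ H.C.Adj a b → f w = a →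
      (∀ z, C'.Adj w z ↔ H.C.Adj (f w) (f z) ∨ f z = b) → ncDeg C' w = 2 := by
    rintro w a b ha hb hab hnab rfl hw
    have h2 : (H.C.neighborSet (f w)).ncard = 2 := H.ncDeg_C (isLeaf_of_C_adj ha.symm)
    have himg : f '' C'.neighborSet w = insert b (H.C.neighborSet (f w) \ {x}) := by
      ext y
      constructor
      · rintro ⟨z, hz, rfl⟩
        rcases (hw z).mp hz with hz | hz
        · exact .inr ⟨hz, hfx z⟩
        · exact .inl hz
      · rintro (rfl | ⟨hy, hyx⟩)
        · obtain ⟨z, rfl⟩ := hf y hb.ne'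
          exact ⟨z, (hw z).mpr (.inr rfl), rfl⟩
        · obtain ⟨z, rfl⟩ := hf y hyx
          exact ⟨z, (hw z).mpr (.inl hy), rfl⟩
    rw [ncDeg_eq_ncard_of_image hinj himg, Set.ncard_insert_of_notMem (by simp [hnab]),
      Set.ncard_sdiff_singleton_of_mem (by exact ha.symm), h2]
  have hdegC : ∀ w, IsLeaf H.T (f w) → ncDeg C' w = 2 := by
    intro w hw
    by_cases hwa : f w = a
    · exact hbypass w a b ha hb hab hnab hwa (by grind)
    by_cases hwb : f w = b
    · exact hbypass w b a hb ha hab.symm (fun h ↦ hnab h.symm) hwb (by grind)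
    · rw [← H.ncDeg_C hw]
      apply ncDeg_eq_ncard_of_image hinj
      ext y
      constructor
      · rintro ⟨z, hz, rfl⟩
        have hz : H.C.Adj (f w) (f z) ∨ f w = a ∧ f z = b ∨ f w = b ∧ f z = a := hz
        rw [mem_neighborSet]
        grind
      · intro hy
        have hy : H.C.Adj (f w) y := hy
        obtain ⟨z, rfl⟩ := hf y (by rintro rfl; have := hCx _ hy.symm; tauto)
        exact ⟨z, .inl hy, rfl⟩
  have hsupp : C'.support = {w | IsLeaf (H.T.comap f) w} := by
    ext w
    rw [Set.mem_ofPred_eq, hleaf]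
    constructor
    · rintro ⟨z, hz | hz | hz⟩
      · exact isLeaf_of_C_adj hz
      · exact hz.1 ▸ hal
      · exact hz.1 ▸ hbl
    · intro hw
      exact exists_adj_of_ncDeg_pos (by rw [hdegC w hw]; norm_num)
  have hconn : ∀ S : Set V, (H.C.induce S).Connected → (∃ y ∈ S, y ≠ x) →
      (C'.induce (f ⁻¹' S)).Connected := fun S hS hne ↦
    hS.induce_preimage_of_bypass hf hCx ha.ne' hb.ne' hfx hinj (fun _ _ h ↦ .inl h)
      (fun _ _ h1 h2 ↦ .inr (.inl ⟨h1, h2⟩)) hne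
  let H' : HalinGraph W :=
    { T := H.T.comap f
      C := C'
      tree_isTree := isTree_comap_of_isLeaf H.tree_isTree hinj hfx hf hvx hx
      four_le_card := by
        have h : (insert v (H.T.neighborSet v)).ncard = (H.T.neighborSet v).ncard + 1 :=
          Set.ncard_insert_of_notMem (by simp)
        have h' := Set.ncard_le_card (insert v (H.T.neighborSet v))
        have : (H.T.neighborSet v).ncard = ncDeg H.T v := rfl
        rw [Nat.card_eq_fintype_card] at h'
        omega
      nonleaf_degree := by
        intro w hw
        by_cases hwv : f w = v
        · rw [ncDeg_comap_of_eq hinj hfx hf hvx hwv]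
          omega
        · rw [ncDeg_comap_of_ne hinj hfx hf hvx hx hwv]
          exact H.nonleaf_degree _ (by rwa [← hleaf])
      support_C := hsupp
      two_regular := by
        intro w hw
        rw [hsupp, Set.mem_ofPred_eq, hleaf] at hw
        exact hdegC w hw
      cycle_connected := by
        have h : C'.support = f ⁻¹' H.C.support := by
          rw [hsupp, H.support_C]
          ext w
          exact hleaf w
        rw [h]
        exact hconn _ H.cycle_connected ⟨a, ⟨x, ha.symm⟩, ha.ne'⟩
      planar := by
        intro u w huw
        have huw : H.T.Adj (f u) (f w) := huw
        have h : {y | IsLeaf (H.T.comap f) y ∧ ((H.T.comap f).deleteEdges {s(u, w)}).Reachable u y}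
            = f ⁻¹' {y | IsLeaf H.T y ∧
              (H.T.deleteEdges {s(f u, f w)}).Reachable (f u) y} := by
          ext y
          exact and_congr (hleaf y)
            (Set.ext_iff.mp (sideOf_comap hinj hfx hf hvx hx u w) y)
        rw [h]
        refine hconn _ (H.planar _ _ huw) ?_
        by_cases hu : IsLeaf H.T (f u)
        · exact ⟨f u, ⟨hu, .rfl⟩, hfx u⟩
        · obtain ⟨y, z, hyz, hyl, hzl, hy, hz⟩ := exists_two_isLeaf_mem_sideOf huw hu
          by_cases hyx : y = x
          · exact ⟨z, ⟨hzl, hz⟩, fun h ↦ hyz (hyx.trans h.symm)⟩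
          · exact ⟨y, ⟨hyl, hy⟩, hyx⟩ }
  refine ⟨H', fun y z ↦ ?_⟩
  change H.T.Adj (f y) (f z) ∨ (H.C.Adj (f y) (f z) ∨ _) ↔ (H.T.Adj _ _ ∨ H.C.Adj _ _) ∨ _
  tauto

end HalinGraph

/-- If the characteristic tree of an `n`-vertex `C₄`-free Halin graph contains a
semi-branching vertex of degree at least `4`, then there is an `(n-1)`-vertex
`C₄`-free Halin graph with exactly two fewer edges. -/
theorem reduce_semibranching {V : Type*} [Fintype V] (H : HalinGraph V)
    (hfree : C4Free H.graph) (v : V) (hsb : SemiBranching H.T v)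
    (hdeg : 4 ≤ ncDeg H.T v) :
    ∃ H' : HalinGraph (Fin (Fintype.card V - 1)),
      C4Free H'.graph ∧ eCount H.graph = eCount H'.graph + 2 := by
  obtain ⟨x, hvx, hx⟩ := hsb.2.1
  obtain ⟨a, b, hab, hnbr⟩ := Set.ncard_eq_two.mp (H.ncDeg_C hx)
  have ha : H.C.Adj x a := by rw [← mem_neighborSet, hnbr]; simp
  have hb : H.C.Adj x b := by rw [← mem_neighborSet, hnbr]; simp
  have hv := hsb.1
  have hal := HalinGraph.isLeaf_of_C_adj ha.symm
  have hbl := HalinGraph.isLeaf_of_C_adj hb.symm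
  classical
  have hcard : Fintype.card {w // w ≠ x} = Fintype.card V - 1 := Set.card_ne_eq x
  let e := (Fintype.equivFinOfCardEq hcard).symm
  let f : Fin (Fintype.card V - 1) → V := fun i ↦ (e i).1
  have hfx : ∀ w, f w ≠ x := fun w ↦ (e w).2
  have hf : ∀ y, y ≠ x → ∃ w, f w = y := fun y hy ↦ ⟨e.symm ⟨y, hy⟩, by simp [f]⟩
  have hinj : Function.Injective f := Subtype.val_injective.comp e.injective
  obtain ⟨H', hH'⟩ := HalinGraph.exists_bypass hsb hdeg hvx hx ha hb hab hfx hf hinj (by simp)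
  refine ⟨H', c4Free_of_bypass hfree hfx hinj ?_ hH',
    eCount_of_bypass (v := v) (.inl hvx.symm) (.inr ha) (.inr hb)
      (by rintro rfl; exact hv hal) (by rintro rfl; exact hv hbl) hab ?_ ?_ hfx hf hinj hH'⟩
  · intro c d had hdc hcb hca hdb hcx hdx
    exact HalinGraph.no_bypass_path hfree hsb hdeg hvx hx ha hb hab had hdc hcb hca hdb hcx hdx
  · rintro z (hz | hz)
    · exact .inl (eq_of_ncDeg_eq_one hx hvx.symm hz)
    · exact .inr (eq_or_eq_of_ncDeg_eq_two (H.ncDeg_C hx) ha hb hab hz)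
  · rintro (h | h)
    · exact HalinGraph.not_T_adj_of_isLeaf hv hal hbl h
    · exact HalinGraph.not_C_adj_bypass hsb hdeg hvx hx ha hb hab h
end
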